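/- arXiv:1310.7165 — 3 statements merged into one kernel-verified Lean document; each statement's English description precedes it below -/
import Mathlib

section
/- For every infinite-dimensional Banach space X and every square-summable sequence of nonnegative reals (λᵢ), there exists a sequence (xᵢ) in X with ‖xᵢ‖ = λᵢ for all i such that the series Σ xᵢ converges unconditionally. In particular, choosing (λᵢ) ∈ ℓ²∖ℓ¹ yields an unconditionally convergent series that is not absolutely convergent (Dvoretzky–Rogers theorem). -/
open Filter

lemma Orthonormal.norm_sq_sum_smul {ι E : Type*} [NormedAddCommGroup E] [InnerProductSpace ℝ E]
    {v : ι → E} (hv : Orthonormal ℝ v) (c : ι → ℝ) (s : Finset ι) :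
    ‖∑ i ∈ s, c i • v i‖ ^ 2 = ∑ i ∈ s, c i ^ 2 := by
  rw [← real_inner_self_eq_norm_sq, hv.inner_sum]
  simp [sq]

/-- A contraction of maximal determinant: no right factor of larger determinant
keeps it a contraction. -/
lemma exists_contraction_det_maximal {E F : Type*} [NormedAddCommGroup E] [NormedSpace ℝ E]
    [FiniteDimensional ℝ E] [NormedAddCommGroup F] [NormedSpace ℝ F] [FiniteDimensional ℝ F]
    (e : F ≃L[ℝ] E) :
    ∃ u : E →L[ℝ] F, ‖u‖ ≤ 1 ∧ ∀ D : E →L[ℝ] E, ‖u ∘L D‖ ≤ 1 → |D.det| ≤ 1 := by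
  have : ProperSpace (E →L[ℝ] F) := FiniteDimensional.proper ℝ _
  obtain ⟨u, hu, hmax⟩ := (isCompact_closedBall (0 : E →L[ℝ] F) 1).exists_isMaxOn
    ⟨0, by simp⟩ (f := fun u => |((e : F →L[ℝ] E) ∘L u).det|)
    ((ContinuousLinearMap.continuous_det.comp
      (continuous_const.clm_comp continuous_id)).abs.continuousOn)
  have hu1 : ‖u‖ ≤ 1 := by simpa using hu
  have det_comp (D : E →L[ℝ] E) : ((e : F →L[ℝ] E) ∘L (u ∘L D)).det =
      ((e : F →L[ℝ] E) ∘L u).det * D.det :=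
    LinearMap.det_comp (((e : F →L[ℝ] E) ∘L u : E →L[ℝ] E) : E →ₗ[ℝ] E) (D : E →ₗ[ℝ] E)
  have hpos : 0 < |((e : F →L[ℝ] E) ∘L u).det| := by
    set c : ℝ := (‖(e.symm : E →L[ℝ] F)‖ + 1)⁻¹
    have hc : 0 < c := by positivity
    have hv : ‖c • (e.symm : E →L[ℝ] F)‖ ≤ 1 := by
      rw [norm_smul, Real.norm_of_nonneg hc.le, inv_mul_le_iff₀ (by positivity)]
      linarith
    refine lt_of_lt_of_le ?_ (hmax (show c • (e.symm : E →L[ℝ] F) ∈ _ by simpa using hv))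
    have : (e : F →L[ℝ] E) ∘L (c • (e.symm : E →L[ℝ] F)) = c • ContinuousLinearMap.id ℝ E := by
      ext x; simp
    simp only [this, abs_pos]
    have h2 : (c • ContinuousLinearMap.id ℝ E).det = c ^ Module.finrank ℝ E := by
      simp [ContinuousLinearMap.det]
    rw [h2]
    positivity
  refine ⟨u, hu1, fun D hD => ?_⟩
  have h := hmax (show u ∘L D ∈ _ by simpa using hD)
  simp only [Set.mem_ofPred_eq, det_comp, abs_mul] at h
  exact le_of_mul_le_mul_left (by simpa using h) hpos

lemma exists_unit_orthogonal_le_norm_apply {E F : Type*} [NormedAddCommGroup E]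
    [InnerProductSpace ℝ E] [FiniteDimensional ℝ E] [NormedAddCommGroup F] [NormedSpace ℝ F]
    {u : E →L[ℝ] F} (hu : ‖u‖ ≤ 1)
    (hdet : ∀ D : E →L[ℝ] E, ‖u ∘L D‖ ≤ 1 → |D.det| ≤ 1)
    {m j : ℕ} (hj : j < m) (b : OrthonormalBasis (Fin (2 * m)) ℝ E) :
    ∃ y : E, ‖y‖ = 1 ∧ (∀ i : Fin (2 * m), (i : ℕ) < j → inner ℝ (b i) y = 0) ∧
      1 / 3 ≤ ‖u y‖ := by
  by_contra! hcon
  have hsmall (q : E) (hq : ∀ i : Fin (2 * m), (i : ℕ) < j → inner ℝ (b i) q = 0) :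
      ‖u q‖ ≤ 1 / 3 * ‖q‖ := by
    rcases eq_or_ne q 0 with rfl | hq0
    · simp
    have hn : 0 < ‖q‖ := norm_pos_iff.2 hq0
    have h := hcon (‖q‖⁻¹ • q) (by simp [norm_smul, hn.ne'])
      (fun i hi => by simp [inner_smul_right, hq i hi])
    rw [map_smul, norm_smul, norm_inv, norm_norm, inv_mul_lt_iff₀ hn] at h
    linarith
  set d : Fin (2 * m) → ℝ := fun i => if (i : ℕ) < j then 7 / 10 else 2 with hd
  set D : E →L[ℝ] E := LinearMap.toContinuousLinearMap
    (Matrix.toLin b.toBasis b.toBasis (Matrix.diagonal d)) with hD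
  have hDdet : D.det = ∏ i, d i := by
    simp [hD, ContinuousLinearMap.det, LinearMap.det_toLin, Matrix.det_diagonal]
  have hprod : ∏ i, d i = (7 / 5) ^ j * 4 ^ (m - j) := by
    rw [hd, Fin.prod_univ_eq_prod_range (fun i => if i < j then (7 / 10 : ℝ) else 2),
      ← Finset.prod_range_mul_prod_Ico _ (show j ≤ 2 * m by lia),
      Finset.prod_congr rfl (g := fun _ => (7 / 10 : ℝ)) (fun i hi => by simp_all),
      Finset.prod_congr (s₁ := Finset.Ico j (2 * m)) rfl (g := fun _ => (2 : ℝ))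
        (fun i hi => by simp_all)]
    simp only [Finset.prod_const, Finset.card_range, Nat.card_Ico]
    rw [show 2 * m - j = j + 2 * (m - j) by lia, pow_add, pow_mul, ← mul_assoc, ← mul_pow]
    norm_num
  have hgt : 1 < D.det := by
    rw [hDdet, hprod]
    exact one_lt_mul_of_le_of_lt (one_le_pow₀ (by norm_num))
      (one_lt_pow₀ (by norm_num) (by lia))
  refine absurd (hdet D ?_) (not_le.2 (hgt.trans_le (le_abs_self _)))
  refine ContinuousLinearMap.opNorm_le_bound _ zero_le_one fun z => ?_
  set c : Fin (2 * m) → ℝ := fun i => inner ℝ (b i) z with hc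
  set S : Finset (Fin (2 * m)) := {i | (i : ℕ) < j} with hS
  set p := ∑ i ∈ S, c i • b i with hp
  set q := ∑ i ∈ Sᶜ, c i • b i with hq
  have hz : ‖z‖ ^ 2 = ‖p‖ ^ 2 + ‖q‖ ^ 2 := by
    rw [hp, hq, b.orthonormal.norm_sq_sum_smul, b.orthonormal.norm_sq_sum_smul,
      Finset.sum_add_sum_compl, ← b.sum_sq_norm_inner_right z]
    simp [hc]
  have hDz : D z = (7 / 10 : ℝ) • p + (2 : ℝ) • q := by
    have : D z = ∑ i, (d i * c i) • b i := by
      simp [hD, Matrix.toLin_apply, Matrix.mulVec_diagonal, hc, b.repr_apply_apply]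
    rw [this, ← Finset.sum_add_sum_compl S, hp, hq, Finset.smul_sum, Finset.smul_sum]
    congr 1 <;> refine Finset.sum_congr rfl fun i hi => ?_ <;> rw [smul_smul] <;> congr 2 <;>
      simp_all
  have hup : ‖u p‖ ≤ ‖p‖ := (u.le_of_opNorm_le hu p).trans_eq (one_mul _)
  have huq : ‖u q‖ ≤ 1 / 3 * ‖q‖ := hsmall q fun i hi => by
    rw [hq, inner_sum]
    refine Finset.sum_eq_zero fun k hk => ?_
    have hik : i ≠ k := by rintro rfl; simp [hS] at hk; lia
    rw [inner_smul_right, b.orthonormal.2 hik, mul_zero]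
  have hbound : ‖(u ∘L D) z‖ ≤ 7 / 10 * ‖p‖ + 2 / 3 * ‖q‖ := by
    rw [ContinuousLinearMap.comp_apply, hDz, map_add, map_smul, map_smul]
    refine (norm_add_le _ _).trans ?_
    rw [norm_smul, norm_smul]
    norm_num
    linarith
  refine hbound.trans (abs_le_of_sq_le_sq' ?_ (by positivity)).2
  rw [one_mul, hz]
  nlinarith [sq_nonneg (2 / 3 * ‖p‖ - 7 / 10 * ‖q‖), sq_nonneg ‖p‖, sq_nonneg ‖q‖]

lemma exists_orthonormalBasis_le_norm_apply {E F : Type*} [NormedAddCommGroup E]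
    [InnerProductSpace ℝ E] [FiniteDimensional ℝ E] [NormedAddCommGroup F] [NormedSpace ℝ F]
    {u : E →L[ℝ] F} (hu : ‖u‖ ≤ 1)
    (hdet : ∀ D : E →L[ℝ] E, ‖u ∘L D‖ ≤ 1 → |D.det| ≤ 1)
    {m : ℕ} (hm : Module.finrank ℝ E = 2 * m) {j : ℕ} (hj : j ≤ m) :
    ∃ b : OrthonormalBasis (Fin (2 * m)) ℝ E,
      ∀ i : Fin (2 * m), (i : ℕ) < j → 1 / 3 ≤ ‖u (b i)‖ := by
  induction j with
  | zero => exact ⟨(stdOrthonormalBasis ℝ E).reindex (finCongr hm), by simp⟩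
  | succ j ih =>
    obtain ⟨b, hb⟩ := ih (by lia)
    obtain ⟨y, hy1, hy, huy⟩ := exists_unit_orthogonal_le_norm_apply hu hdet hj b
    let k : Fin (2 * m) := ⟨j, by lia⟩
    have hlt {i : Fin (2 * m)} (hi : (i : ℕ) < j + 1) (hik : i ≠ k) : (i : ℕ) < j := by
      have : (i : ℕ) ≠ j := fun h => hik (Fin.ext h)
      lia
    set s : Set (Fin (2 * m)) := {i | (i : ℕ) < j + 1}
    have hv : Orthonormal ℝ (s.domRestrict (Function.update b k y)) := by
      constructor
      · rintro ⟨i, hi⟩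
        rcases eq_or_ne i k with rfl | hik <;> simp [*]
      · rintro ⟨i, hi⟩ ⟨l, hl⟩ hil
        have hil : i ≠ l := fun h => hil (Subtype.ext h)
        simp only [Set.domRestrict_apply]
        rcases eq_or_ne i k with rfl | hik
        · rw [Function.update_self, Function.update_of_ne hil.symm, real_inner_comm]
          exact hy l (hlt hl hil.symm)
        · rw [Function.update_of_ne hik]
          rcases eq_or_ne l k with rfl | hlk
          · rw [Function.update_self]
            exact hy i (hlt hi hik)
          · rw [Function.update_of_ne hlk]
            exact b.orthonormal.2 hil
    obtain ⟨b', hb'⟩ := Orthonormal.exists_orthonormalBasis_extension_of_card_eq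
      (by simpa using hm) hv
    refine ⟨b', fun i hi => ?_⟩
    rw [hb' i hi]
    rcases eq_or_ne i k with rfl | hik
    · simpa using huy
    · simpa [hik] using hb i (hlt hi hik)

/-- The Dvoretzky–Rogers lemma, up to the constant. -/
lemma exists_unit_vectors_norm_sq_sum_le {X : Type*} [NormedAddCommGroup X] [NormedSpace ℝ X]
    (hX : ¬ FiniteDimensional ℝ X) (m : ℕ) :
    ∃ y : ℕ → X, (∀ i < m, ‖y i‖ = 1) ∧ ∀ (t : ℕ → ℝ) (s : Finset ℕ), (∀ i ∈ s, i < m) →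
      ‖∑ i ∈ s, t i • y i‖ ^ 2 ≤ 9 * ∑ i ∈ s, t i ^ 2 := by
  have hrank : ((2 * m : ℕ) : Cardinal) ≤ Module.rank ℝ X :=
    Cardinal.natCast_le_aleph0.trans
      (not_lt.1 fun h => hX (Module.rank_lt_aleph0_iff.1 h))
  obtain ⟨w, hw⟩ := exists_linearIndependent_of_le_rank hrank
  let F := Submodule.span ℝ (Set.range w)
  have hF : Module.finrank ℝ F = 2 * m := by simpa using finrank_span_eq_card hw
  have : FiniteDimensional ℝ F := FiniteDimensional.span_of_finite ℝ (Set.finite_range w)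
  let E := EuclideanSpace ℝ (Fin (2 * m))
  have hE : Module.finrank ℝ E = 2 * m := by simp [E]
  obtain ⟨u, hu, hdet⟩ := exists_contraction_det_maximal
    (ContinuousLinearEquiv.ofFinrankEq (hF.trans hE.symm))
  obtain ⟨b, hb⟩ := exists_orthonormalBasis_le_norm_apply hu hdet hE le_rfl
  let v : ℕ → E := fun i => if h : i < 2 * m then b ⟨i, h⟩ else 0
  have hv {i : ℕ} (hi : i < m) : 1 / 3 ≤ ‖u (v i)‖ := by
    simpa [v, show i < 2 * m by lia] using hb ⟨i, by lia⟩ hi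
  refine ⟨fun i => ‖u (v i)‖⁻¹ • (u (v i) : X), fun i hi => ?_, fun t s hs => ?_⟩
  · have := hv hi
    have h0 : ‖u (v i)‖ ≠ 0 := by linarith
    rw [norm_smul, norm_inv, norm_norm]
    exact inv_mul_cancel₀ h0
  · have hsum : ∑ i ∈ s, t i • ‖u (v i)‖⁻¹ • (u (v i) : X) =
        (u (∑ i ∈ s, (t i * ‖u (v i)‖⁻¹) • v i) : X) := by
      simp [mul_smul]
    have horth : Orthonormal ℝ fun i : s => v i := by
      have : (fun i : s => v i) = b ∘ fun i : s => ⟨i, by have := hs i i.2; lia⟩ := by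
        ext1 i
        simp [v, show (i : ℕ) < 2 * m by have := hs i i.2; lia]
      rw [this]
      exact b.orthonormal.comp _ fun i l h => Subtype.ext (by simpa using h)
    have hle : ‖u (∑ i ∈ s, (t i * ‖u (v i)‖⁻¹) • v i)‖ ≤
        ‖∑ i ∈ s, (t i * ‖u (v i)‖⁻¹) • v i‖ :=
      (u.le_of_opNorm_le hu _).trans_eq (one_mul _)
    rw [hsum, Submodule.norm_coe]
    refine (pow_le_pow_left₀ (norm_nonneg _) hle 2).trans ?_
    rw [← Finset.sum_coe_sort s, horth.norm_sq_sum_smul (fun i : s => t i * ‖u (v i)‖⁻¹),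
      Finset.sum_coe_sort s fun i => (t i * ‖u (v i)‖⁻¹) ^ 2, Finset.mul_sum]
    refine Finset.sum_le_sum fun i hi => ?_
    have h3 : ‖u (v i)‖⁻¹ ≤ 3 := by
      rw [inv_le_comm₀ (by linarith [hv (hs i hi)]) (by norm_num)]
      linarith [hv (hs i hi)]
    rw [mul_pow, mul_comm]
    refine mul_le_mul_of_nonneg_right ?_ (sq_nonneg _)
    nlinarith [inv_nonneg.2 (norm_nonneg (u (v i)))]

lemma exists_summable_norm_eq {X : Type*} [NormedAddCommGroup X] [NormedSpace ℝ X]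
    [CompleteSpace X] (hX : ¬ FiniteDimensional ℝ X) {lam : ℕ → ℝ} (hpos : ∀ i, 0 ≤ lam i)
    (hsq : Summable fun i => lam i ^ 2) :
    ∃ x : ℕ → X, (∀ i, ‖x i‖ = lam i) ∧ Summable x := by
  have htail (k : ℕ) : ∃ N : ℕ, k ≤ N ∧ ∀ s : Finset ℕ, (∀ i ∈ s, N ≤ i) →
      ∑ i ∈ s, lam i ^ 2 ≤ (1 / 4) ^ k := by
    obtain ⟨S, hS⟩ := summable_iff_vanishing_norm.1 hsq ((1 / 4) ^ k) (by positivity)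
    refine ⟨max k (S.sup id + 1), le_max_left _ _, fun s hs => ?_⟩
    refine (Real.le_norm_self _).trans (hS s ?_).le
    refine Finset.disjoint_left.2 fun i hi hiS => ?_
    have h1 := hs i hi
    have h2 : i ≤ S.sup id := Finset.le_sup (f := id) hiS
    lia
  choose N hN hNtail using htail
  have hex (i : ℕ) : ∃ k, i < N k := ⟨i + 1, (hN (i + 1))⟩
  let g : ℕ → ℕ := fun i => Nat.find (hex i)
  have hg (i : ℕ) : i < N (g i) := Nat.find_spec (hex i)
  have hg' {i k : ℕ} (h : g i = k + 1) : N k ≤ i :=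
    not_lt.1 (Nat.find_min (hex i) (show k < g i by lia))
  choose y hy1 hy using fun k => exists_unit_vectors_norm_sq_sum_le hX (N k)
  refine ⟨fun i => lam i • y (g i) i, fun i => ?_, ?_⟩
  · rw [norm_smul, hy1 _ _ (hg i), mul_one, Real.norm_of_nonneg (hpos i)]
  have hblock (k : ℕ) (t : Finset ℕ) (ht : ∀ i ∈ t, g i = k + 1) :
      ‖∑ i ∈ t, lam i • y (g i) i‖ ≤ 6 * (1 / 2) ^ (k + 1) := by
    rw [Finset.sum_congr rfl fun i hi => by rw [ht i hi]]
    have h1 := hy (k + 1) lam t fun i hi => ht i hi ▸ hg i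
    have h2 := hNtail k t fun i hi => hg' (ht i hi)
    refine (abs_le_of_sq_le_sq' (h1.trans ?_) (by positivity)).2
    have h3 : (6 * (1 / 2 : ℝ) ^ (k + 1)) ^ 2 = 9 * (1 / 4) ^ k := by
      rw [mul_pow, ← pow_mul, mul_comm (k + 1), pow_mul, pow_succ]
      norm_num
      ring
    linarith
  have hgeom : Summable fun k : ℕ => 6 * (1 / 2 : ℝ) ^ k := summable_geometric_two.mul_left 6
  refine summable_iff_vanishing_norm.2 fun ε hε => ?_
  obtain ⟨S, hS⟩ := summable_iff_vanishing_norm.1 hgeom ε hε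
  refine ⟨Finset.range ((insert 0 S).sup N), fun t ht => ?_⟩
  have hgt {i : ℕ} (hi : i ∈ t) : g i ∉ insert 0 S := fun hgi =>
    Finset.disjoint_left.1 ht hi
      (Finset.mem_range.2 ((hg i).trans_le (Finset.le_sup (f := N) hgi)))
  rw [← Finset.sum_fiberwise_of_maps_to (t := t.image g)
    fun i hi => Finset.mem_image_of_mem g hi]
  calc ‖∑ k ∈ t.image g, ∑ i ∈ t with g i = k, lam i • y (g i) i‖
      ≤ ∑ k ∈ t.image g, 6 * (1 / 2 : ℝ) ^ k := by
        refine norm_sum_le_of_le _ fun k hk => ?_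
        obtain ⟨i, hi, rfl⟩ := Finset.mem_image.1 hk
        have h0 : g i ≠ 0 := fun h => hgt hi (by simp [h])
        obtain ⟨k, hk⟩ := Nat.exists_eq_succ_of_ne_zero h0
        rw [hk]
        exact hblock k _ fun l hl => (Finset.mem_filter.1 hl).2
    _ ≤ ‖∑ k ∈ t.image g, 6 * (1 / 2 : ℝ) ^ k‖ := Real.le_norm_self _
    _ < ε := by
        refine hS _ (Finset.disjoint_left.2 fun k hk hkS => ?_)
        obtain ⟨i, hi, rfl⟩ := Finset.mem_image.1 hk
        exact hgt hi (Finset.mem_insert_of_mem hkS)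

/-- Dvoretzky–Rogers: in every infinite-dimensional Banach space and for every
square-summable sequence of nonnegative reals `(λᵢ)`, there is an
unconditionally convergent series `Σ xᵢ` with `‖xᵢ‖ = λᵢ`. -/
theorem dvoretzky_rogers
    {X : Type} [NormedAddCommGroup X] [NormedSpace ℝ X] [CompleteSpace X]
    (hX : ¬ FiniteDimensional ℝ X)
    (lam : ℕ → ℝ) (hpos : ∀ i, 0 ≤ lam i)
    (hsq : Summable fun i => lam i ^ 2) :
    ∃ x : ℕ → X, (∀ i, ‖x i‖ = lam i) ∧
      ∀ π : Equiv.Perm ℕ, ∃ s : X,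
        Tendsto (fun N => ∑ n ∈ Finset.range N, x (π n)) atTop (nhds s) := by
  obtain ⟨x, hx, hsum⟩ := exists_summable_norm_eq hX hpos hsq
  exact ⟨x, hx, fun π => ⟨_, (π.summable_iff.2 hsum).hasSum.tendsto_sum_nat⟩⟩
end

section
/- If a Banach space X is infinite-dimensional, then the set uc(X) ∖ abc(X) of unconditionally convergent but not absolutely convergent series in X, together with zero, contains a linear subspace of dimension equal to the cardinality of the continuum. -/
open Filter

/-- A sequence is an unconditionally convergent series. -/
def UncondConv {X : Type} [NormedAddCommGroup X] (x : ℕ → X) : Prop :=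
  ∀ π : Equiv.Perm ℕ, ∃ s : X,
    Tendsto (fun N => ∑ n ∈ Finset.range N, x (π n)) atTop (nhds s)

/-- A sequence is an absolutely convergent series. -/
def AbsConv {X : Type} [NormedAddCommGroup X] (x : ℕ → X) : Prop :=
  Summable fun n => ‖x n‖


section DvoretzkyRogers

variable {X H : Type*} [NormedAddCommGroup X] [NormedSpace ℝ X]
  [NormedAddCommGroup H] [InnerProductSpace ℝ H] [FiniteDimensional ℝ H]

open Module

/-- Obtained by maximising the determinant over the contractions factoring through `T`. -/
theorem exists_contraction_det_le_pow {T : H →L[ℝ] X} (hT : Function.Injective T) :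
    ∃ u : H →L[ℝ] X, ‖u‖ ≤ 1 ∧ ∀ (B : H →L[ℝ] H) (s : ℝ), 0 < s → ‖u.comp B‖ ≤ s →
      B.det ≤ s ^ finrank ℝ H := by
  obtain ⟨K, -, hK⟩ := (T : H →ₗ[ℝ] X).exists_antilipschitzWith (LinearMap.ker_eq_bot.2 hT)
  let C : Set (H →L[ℝ] H) := {A | ‖T.comp A‖ ≤ 1}
  have hcont : Continuous fun A : H →L[ℝ] H => T.comp A := by fun_prop
  have hclosed : IsClosed C := isClosed_le hcont.norm continuous_const
  have hbdd : Bornology.IsBounded C := by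
    refine (Metric.isBounded_closedBall (x := (0 : H →L[ℝ] H)) (r := K)).subset fun A hA => ?_
    rw [mem_closedBall_zero_iff]
    refine A.opNorm_le_bound K.2 fun z => ?_
    have h₁ : ‖A z‖ ≤ K * ‖T (A z)‖ := by
      simpa [dist_eq_norm] using hK.le_mul_dist (A z) 0
    have h₂ : ‖T (A z)‖ ≤ 1 * ‖z‖ := (T.comp A).le_of_opNorm_le hA z
    calc ‖A z‖ ≤ K * ‖T (A z)‖ := h₁
      _ ≤ K * ‖z‖ := by gcongr; simpa using h₂
  have : ProperSpace (H →L[ℝ] H) := FiniteDimensional.proper ℝ _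
  have hcomp : IsCompact C := Metric.isCompact_of_isClosed_isBounded hclosed hbdd
  have hpos : 0 < ‖T‖ + 1 := by positivity
  have hmem : (‖T‖ + 1)⁻¹ • ContinuousLinearMap.id ℝ H ∈ C := by
    change ‖T.comp _‖ ≤ 1
    rw [ContinuousLinearMap.comp_smul, ContinuousLinearMap.comp_id, norm_smul, norm_inv,
      Real.norm_of_nonneg hpos.le, inv_mul_le_iff₀ hpos]
    linarith
  have det_smul (c : ℝ) (A : H →L[ℝ] H) : (c • A).det = c ^ finrank ℝ H * A.det := by
    simp [ContinuousLinearMap.det]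
  obtain ⟨A, hA, hmax⟩ := hcomp.exists_isMaxOn ⟨_, hmem⟩
    (ContinuousLinearMap.continuous_det (𝕜 := ℝ) (E := H)).continuousOn
  have hApos : 0 < A.det := by
    refine lt_of_lt_of_le ?_ (hmax hmem)
    change 0 < ContinuousLinearMap.det _
    rw [det_smul]
    have : (ContinuousLinearMap.id ℝ H).det = 1 := by simp [ContinuousLinearMap.det]
    rw [this]
    positivity
  refine ⟨T.comp A, hA, fun B s hs hB => ?_⟩
  have hmem' : s⁻¹ • A.comp B ∈ C := by
    change ‖T.comp _‖ ≤ 1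
    rw [ContinuousLinearMap.comp_smul, norm_smul, norm_inv, Real.norm_of_nonneg hs.le,
      inv_mul_le_iff₀ hs, mul_one]
    exact hB
  have hle : (s⁻¹ • A.comp B).det ≤ A.det := hmax hmem'
  have hdet : (A.comp B).det = A.det * B.det := by
    simp [ContinuousLinearMap.det]
  rw [det_smul, hdet, inv_pow, inv_mul_le_iff₀ (by positivity), mul_comm] at hle
  exact le_of_mul_le_mul_right hle hApos

theorem det_id_add_starProjection (W : Submodule ℝ H) :
    (ContinuousLinearMap.id ℝ H + W.starProjection).det = 2 ^ finrank ℝ W := by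
  let e := W.prodEquivOfIsCompl _ W.isCompl_orthogonal
  let b := (finBasis ℝ W).prod (finBasis ℝ Wᗮ)
  let f : H →ₗ[ℝ] H := ↑(ContinuousLinearMap.id ℝ H + W.starProjection)
  have h₁ (x : W) : f x = (2 : ℝ) • (x : H) := by
    simp [f, two_smul, Submodule.starProjection_eq_self_iff.2 x.2]
  have h₂ (x : Wᗮ) : f x = x := by
    simp [f, (Submodule.starProjection_apply_eq_zero_iff W).2 x.2]
  have hm : LinearMap.toMatrix b b (e.symm ∘ₗ f ∘ₗ e.symm.symm) =
      Matrix.fromBlocks ((2 : ℝ) • 1) 0 0 1 := by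
    ext (_ | _) (_ | _) <;>
    simp [LinearMap.toMatrix_apply, b, Matrix.one_apply, Finsupp.single_apply, e, eq_comm, h₁, h₂]
  change LinearMap.det f = _
  rw [← LinearMap.det_conj _ e.symm, ← LinearMap.det_toMatrix b, hm,
    Matrix.det_fromBlocks_zero₂₁, Matrix.det_one, mul_one, Matrix.det_smul]
  simp

theorem exists_orthonormal_le_norm_apply {u : H →L[ℝ] X} (hu : ‖u‖ ≤ 1)
    (hdet : ∀ (B : H →L[ℝ] H) (s : ℝ), 0 < s → ‖u.comp B‖ ≤ s → B.det ≤ s ^ finrank ℝ H)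
    {k : ℕ} (hk : finrank ℝ H = 2 * k) :
    ∀ j ≤ k, ∃ v : Fin j → H, Orthonormal ℝ v ∧ ∀ i, 1 / 4 ≤ ‖u (v i)‖ := by
  intro j
  induction j with
  | zero => exact fun _ => ⟨Fin.elim0, ⟨fun i => i.elim0, fun i => i.elim0⟩, fun i => i.elim0⟩
  | succ j ih =>
    intro hj
    obtain ⟨v, hv, hvu⟩ := ih (by omega)
    let V : Submodule ℝ H := Submodule.span ℝ (Set.range v)
    suffices ∃ y ∈ Vᗮ, ‖y‖ = 1 ∧ 1 / 4 ≤ ‖u y‖ by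
      obtain ⟨y, hy, hy1, hyu⟩ := this
      refine ⟨Matrix.vecCons y v, orthonormal_vecCons_iff.2 ⟨hy1, fun i => ?_, hv⟩, fun i => ?_⟩
      · exact Submodule.inner_left_of_mem_orthogonal
          (Submodule.subset_span (Set.mem_range_self i)) hy
      · refine Fin.cases ?_ (fun i => ?_) i
        · simpa using hyu
        · simpa using hvu i
    by_contra! hcon
    have hsmall : ∀ y ∈ Vᗮ, ‖u y‖ ≤ 1 / 4 * ‖y‖ := by
      intro y hy
      rcases eq_or_ne y 0 with rfl | hy0
      · simp
      have hny : 0 < ‖y‖ := norm_pos_iff.2 hy0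
      have := hcon (‖y‖⁻¹ • y) (Vᗮ.smul_mem _ hy) (by simp [norm_smul, hny.ne'])
      rw [map_smul, norm_smul, norm_inv, norm_norm, inv_mul_lt_iff₀ hny] at this
      linarith
    have hnorm : ‖u.comp (ContinuousLinearMap.id ℝ H + Vᗮ.starProjection)‖ ≤ 5 / 4 := by
      refine ContinuousLinearMap.opNorm_le_bound _ (by norm_num) fun z => ?_
      have h₁ : ‖u z‖ ≤ 1 * ‖z‖ := u.le_of_opNorm_le hu z
      have h₂ := hsmall _ (Vᗮ.starProjection_apply_mem z)
      have h₃ : ‖Vᗮ.starProjection z‖ ≤ ‖z‖ := Vᗮ.norm_starProjection_apply_le z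
      calc ‖u (z + Vᗮ.starProjection z)‖ ≤ ‖u z‖ + ‖u (Vᗮ.starProjection z)‖ := by
            rw [map_add]; exact norm_add_le _ _
        _ ≤ 5 / 4 * ‖z‖ := by linarith
    have hd := hdet _ _ (by norm_num) hnorm
    have hV : finrank ℝ V = j := by simpa using finrank_span_eq_card hv.linearIndependent
    have hVo := V.finrank_add_finrank_orthogonal
    rw [det_id_add_starProjection, hk, pow_mul] at hd
    have h₁ : (2 : ℝ) ^ k ≤ 2 ^ finrank ℝ Vᗮ :=
      pow_le_pow_right₀ (by norm_num) (by omega)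
    have h₂ : ((5 / 4 : ℝ) ^ 2) ^ k < 2 ^ k :=
      pow_lt_pow_left₀ (by norm_num) (by norm_num) (by omega)
    linarith

/-- A form of the Dvoretzky–Rogers lemma. -/
theorem exists_family_le_norm_and_norm_sum_smul_le (hX : ¬ FiniteDimensional ℝ X) (k : ℕ) :
    ∃ x : Fin k → X, (∀ i, 1 / 4 ≤ ‖x i‖) ∧
      ∀ (a : Fin k → ℝ) (M : ℝ), 0 ≤ M → (∀ i, |a i| ≤ M) → ‖∑ i, a i • x i‖ ≤ M * √k := by
  have hrank : ((2 * k : ℕ) : Cardinal) ≤ Module.rank ℝ X := by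
    refine Cardinal.natCast_le_aleph0.trans ?_
    rw [← not_lt, Module.rank_lt_aleph0_iff]
    exact hX
  obtain ⟨f, hf⟩ := Module.le_rank_iff_exists_linearMap.1 hrank
  let g : EuclideanSpace ℝ (Fin (2 * k)) →ₗ[ℝ] X :=
    f ∘ₗ (WithLp.linearEquiv 2 ℝ (Fin (2 * k) → ℝ)).toLinearMap
  have hg : Function.Injective g.toContinuousLinearMap :=
    hf.comp (WithLp.linearEquiv 2 ℝ (Fin (2 * k) → ℝ)).injective
  obtain ⟨u, hu, hdet⟩ := exists_contraction_det_le_pow hg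
  obtain ⟨v, hv, hvu⟩ := exists_orthonormal_le_norm_apply hu hdet (k := k) (by simp) k le_rfl
  refine ⟨fun i => u (v i), hvu, fun a M hM ha => ?_⟩
  have hsq : ‖∑ i, a i • v i‖ ^ 2 ≤ M ^ 2 * k := by
    rw [← real_inner_self_eq_norm_sq, hv.inner_sum]
    calc ∑ i, (starRingEnd ℝ) (a i) * a i ≤ ∑ _i : Fin k, M ^ 2 := by
          refine Finset.sum_le_sum fun i _ => ?_
          rw [conj_trivial, ← sq]
          exact sq_le_sq' (by linarith [abs_le.1 (ha i)]) (abs_le.1 (ha i)).2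
      _ = M ^ 2 * k := by simp [mul_comm]
  calc ‖∑ i, a i • u (v i)‖ = ‖u (∑ i, a i • v i)‖ := by simp
    _ ≤ 1 * ‖∑ i, a i • v i‖ := u.le_of_opNorm_le hu _
    _ ≤ √(M ^ 2 * k) := by rw [one_mul]; exact Real.le_sqrt_of_sq_le hsq
    _ = M * √k := by rw [Real.sqrt_mul (sq_nonneg M), Real.sqrt_sq hM]

theorem exists_bounded_multiplier_summable_blocks [CompleteSpace X]
    (hX : ¬ FiniteDimensional ℝ X) :
    ∃ z : (Σ j : ℕ, Fin (16 ^ j)) → X,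
      (∀ (c : (Σ j : ℕ, Fin (16 ^ j)) → ℝ) (M : ℝ), (∀ p, |c p| ≤ M) →
        Summable fun p => c p • z p) ∧
      ∀ j, 1 / 4 ≤ ∑ i, ‖z ⟨j, i⟩‖ := by
  choose x hx hxsum using fun j : ℕ => exists_family_le_norm_and_norm_sum_smul_le hX (16 ^ j)
  refine ⟨fun p => (1 / 8 : ℝ) ^ p.1 • x p.1 p.2, fun c M hc => ?_, fun j => ?_⟩
  · have hM : 0 ≤ M := (abs_nonneg _).trans (hc ⟨0, ⟨0, by simp⟩⟩)
    have hblock (j : ℕ) (a : Fin (16 ^ j) → ℝ) (ha : ∀ i, |a i| ≤ M) :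
        ‖∑ i, a i • (1 / 8 : ℝ) ^ j • x j i‖ ≤ M * (1 / 2) ^ j := by
      have hsqrt : √((16 ^ j : ℕ) : ℝ) = 4 ^ j := by
        rw [show ((16 ^ j : ℕ) : ℝ) = (4 ^ j) ^ 2 by
          push_cast; rw [← pow_mul, mul_comm, pow_mul]; norm_num]
        exact Real.sqrt_sq (by positivity)
      have hxj := hxsum j a M hM ha
      rw [hsqrt] at hxj
      calc ‖∑ i, a i • (1 / 8 : ℝ) ^ j • x j i‖
          = (1 / 8 : ℝ) ^ j * ‖∑ i, a i • x j i‖ := by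
            simp_rw [smul_comm (a _)]
            rw [← Finset.smul_sum, norm_smul, Real.norm_of_nonneg (by positivity)]
        _ ≤ (1 / 8 : ℝ) ^ j * (M * 4 ^ j) := by gcongr
        _ = M * (1 / 2) ^ j := by
            rw [mul_left_comm, ← mul_pow]; norm_num
    have hgeom : Summable fun j : ℕ => M * (1 / 2 : ℝ) ^ j :=
      summable_geometric_two.mul_left M
    rw [summable_iff_vanishing_norm]
    intro ε hε
    obtain ⟨s, hs⟩ := summable_iff_vanishing_norm.1 hgeom ε hε
    refine ⟨s.sigma fun _ => Finset.univ, fun F hF => ?_⟩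
    classical
    have hdisj : Disjoint (F.image Sigma.fst) s := by
      rw [Finset.disjoint_left] at hF ⊢
      intro j hj hjs
      obtain ⟨p, hp, rfl⟩ := Finset.mem_image.1 hj
      exact hF hp (by simpa using hjs)
    have hsub : F ⊆ (F.image Sigma.fst).sigma fun _ => Finset.univ := fun p hp => by
      simpa using ⟨p.2, hp⟩
    have hsum : ∑ p ∈ F, c p • (1 / 8 : ℝ) ^ p.1 • x p.1 p.2 =
        ∑ j ∈ F.image Sigma.fst, ∑ i : Fin (16 ^ j),
          (if (⟨j, i⟩ : Σ j : ℕ, Fin (16 ^ j)) ∈ F then c ⟨j, i⟩ else 0) •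
            (1 / 8 : ℝ) ^ j • x j i := by
      rw [← Finset.sum_sigma (F.image Sigma.fst) (fun j => (Finset.univ : Finset (Fin (16 ^ j))))
        (fun p => (if p ∈ F then c p else 0) • (1 / 8 : ℝ) ^ p.1 • x p.1 p.2)]
      simp_rw [ite_smul, zero_smul]
      rw [Finset.sum_ite_mem, Finset.inter_eq_right.2 hsub]
    rw [hsum]
    calc _ ≤ ∑ j ∈ F.image Sigma.fst, M * (1 / 2 : ℝ) ^ j := by
          refine norm_sum_le_of_le _ fun j _ => hblock j _ fun i => ?_
          split_ifs
          · exact hc _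
          · simpa using hM
      _ ≤ ‖∑ j ∈ F.image Sigma.fst, M * (1 / 2 : ℝ) ^ j‖ := Real.le_norm_self _
      _ < ε := hs _ hdisj
  · calc (1 / 4 : ℝ) ≤ 2 ^ j * (1 / 4) := by
          linarith [one_le_pow₀ (n := j) (one_le_two (α := ℝ))]
      _ = ∑ _i : Fin (16 ^ j), (1 / 8 : ℝ) ^ j * (1 / 4) := by
          rw [Finset.sum_const, Finset.card_univ, Fintype.card_fin, nsmul_eq_mul, ← mul_assoc]
          push_cast
          rw [← mul_pow]
          norm_num
      _ ≤ ∑ i, ‖(1 / 8 : ℝ) ^ j • x j i‖ := by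
          refine Finset.sum_le_sum fun i _ => ?_
          rw [norm_smul, Real.norm_of_nonneg (by positivity)]
          gcongr
          exact hx j i

end DvoretzkyRogers

theorem linearIndependent_pow_sequences : LinearIndependent ℝ fun (r : ℝ) (n : ℕ) => r ^ n := by
  let shift : Module.End ℝ (ℕ → ℝ) := LinearMap.funLeft ℝ ℝ Nat.succ
  refine shift.eigenvectors_linearIndependent' id Function.injective_id _ fun r => ?_
  refine Module.End.hasEigenvector_iff.2 ⟨Module.End.mem_eigenspace_iff.2 ?_, fun h => ?_⟩
  · ext n
    simp [shift, LinearMap.funLeft_apply, pow_succ']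
  · simpa using congrFun h 0

theorem exists_submodule_bounded_rank_eq_continuum :
    ∃ V : Submodule ℝ (ℕ → ℝ), Module.rank ℝ V = Cardinal.continuum ∧
      ∀ h ∈ V, ∃ M, ∀ n, |h n| ≤ M := by
  let v : Set.Ioo (0 : ℝ) 1 → ℕ → ℝ := fun r n => (r : ℝ) ^ n
  have hv : LinearIndependent ℝ v :=
    linearIndependent_pow_sequences.comp _ Subtype.val_injective
  refine ⟨Submodule.span ℝ (Set.range v), ?_, fun h hh => ?_⟩
  · rw [rank_span hv, Cardinal.mk_range_eq v hv.injective, Cardinal.mk_Ioo_real one_pos]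
  · induction hh using Submodule.span_induction with
    | mem h hh =>
      obtain ⟨r, rfl⟩ := hh
      refine ⟨1, fun n => ?_⟩
      rw [abs_pow, abs_of_pos r.2.1]
      exact pow_le_one₀ r.2.1.le r.2.2.le
    | zero => exact ⟨0, by simp⟩
    | add f g _ _ hf hg =>
      obtain ⟨M, hM⟩ := hf
      obtain ⟨N, hN⟩ := hg
      exact ⟨M + N, fun n => (abs_add_le _ _).trans (add_le_add (hM n) (hN n))⟩
    | smul c f _ hf =>
      obtain ⟨M, hM⟩ := hf
      refine ⟨|c| * M, fun n => ?_⟩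
      rw [Pi.smul_apply, smul_eq_mul, abs_mul]
      exact mul_le_mul_of_nonneg_left (hM n) (abs_nonneg c)

theorem Summable.uncondConv {X : Type} [NormedAddCommGroup X] [CompleteSpace X] {x : ℕ → X}
    (hx : Summable x) :
    UncondConv x := fun π =>
  ⟨_, (hx.comp_injective π.injective).hasSum.tendsto_sum_nat⟩

/-- In an infinite-dimensional Banach space, the set of unconditionally but
not absolutely convergent series, together with zero, contains a linear
subspace of dimension the continuum. -/
theorem uc_minus_abc_contains_continuum_dimensional_subspace
    {X : Type} [NormedAddCommGroup X] [NormedSpace ℝ X] [CompleteSpace X]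
    (hX : ¬ FiniteDimensional ℝ X) :
    ∃ S : Submodule ℝ (ℕ → X), Module.rank ℝ S = Cardinal.continuum ∧
      ∀ x ∈ S, x ≠ 0 → UncondConv x ∧ ¬ AbsConv x := by
  obtain ⟨z, hz, hzblock⟩ := exists_bounded_multiplier_summable_blocks hX
  obtain ⟨V, hVrank, hVbdd⟩ := exists_submodule_bounded_rank_eq_continuum
  have : Infinite (Σ j : ℕ, Fin (16 ^ j)) :=
    Infinite.of_injective (fun j : ℕ => (⟨j, ⟨0, by positivity⟩⟩ : Σ j : ℕ, Fin (16 ^ j)))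
      fun i j h => congrArg Sigma.fst h
  obtain ⟨e⟩ := nonempty_equiv_of_countable (α := ℕ) (β := Σ j : ℕ, Fin (16 ^ j))
  let T : (ℕ → ℝ) →ₗ[ℝ] (ℕ → X) :=
    { toFun := fun h n => h (Nat.unpair (e n).1).1 • z (e n)
      map_add' := fun f g => by ext n; simp [add_smul]
      map_smul' := fun c f => by ext n; simp [mul_smul] }
  have hT_not_abs (h : ℕ → ℝ) (hh : h ≠ 0) : ¬ AbsConv (T h) := by
    intro habs
    obtain ⟨k, hk⟩ := Function.ne_iff.1 hh
    have hsum : Summable fun p : Σ j : ℕ, Fin (16 ^ j) => ‖h (Nat.unpair p.1).1 • z p‖ :=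
      e.summable_iff.1 habs
    have hinj : Function.Injective fun m => Nat.pair k m := fun a b hab => by
      simpa using hab
    have hlim := (hsum.sigma.comp_injective hinj).tendsto_atTop_zero
    have hlow (m : ℕ) : |h k| * (1 / 4) ≤
        ∑' i : Fin (16 ^ Nat.pair k m), ‖h (Nat.unpair (Nat.pair k m)).1 • z ⟨Nat.pair k m, i⟩‖ := by
      simp_rw [norm_smul, Nat.unpair_pair, Real.norm_eq_abs]
      rw [tsum_fintype, ← Finset.mul_sum]
      gcongr
      exact hzblock _
    have hle : |h k| * (1 / 4) ≤ 0 := ge_of_tendsto' hlim hlow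
    have : 0 < |h k| := abs_pos.2 hk
    linarith
  have hT_inj : Function.Injective T := by
    refine (injective_iff_map_eq_zero T).2 fun h hh => ?_
    by_contra hne
    refine hT_not_abs h hne ?_
    rw [hh]
    simp [AbsConv]
  refine ⟨V.map T, ?_, ?_⟩
  · rw [← (Submodule.equivMapOfInjective T hT_inj V).rank_eq, hVrank]
  · rintro _ ⟨h, hh, rfl⟩ hne
    obtain ⟨M, hM⟩ := hVbdd h hh
    refine ⟨Summable.uncondConv ?_, hT_not_abs h fun h0 => hne (by rw [h0, map_zero])⟩
    exact e.summable_iff.2 (hz (fun p => h (Nat.unpair p.1).1) M fun p => hM _)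
end

section
/- For a Banach space X of dimension at least 3, every bounded linear operator defined on an arbitrary closed subspace of X with values in an arbitrary Banach space extends to a bounded linear operator on all of X if and only if X is isomorphic to a Hilbert space. -/
open MeasureTheory ProbabilityTheory Filter Topology
open scoped RealInnerProductSpace

section Gaussian

lemma abs_sub_le_of_subgradient {V : Type*} [NormedAddCommGroup V]
    [InnerProductSpace ℝ V] {F : V → ℝ} {G : V → V} (hG1 : ∀ x, ‖G x‖ ≤ 1)
    (hsub : ∀ x y, F x + ⟪G x, y - x⟫ ≤ F y) (x y : V) : |F y - F x| ≤ ‖y - x‖ := by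
  have h : ∀ x y, F x - F y ≤ ‖y - x‖ := fun x y => by
    have h1 := hsub x y
    have h2 : |⟪G x, y - x⟫| ≤ 1 * ‖y - x‖ :=
      (abs_real_inner_le_norm _ _).trans (by gcongr; exact hG1 x)
    have := neg_abs_le ⟪G x, y - x⟫
    linarith
  rw [abs_le]
  have h1 := h x y
  have h2 := h y x
  rw [norm_sub_rev] at h2
  constructor <;> linarith

variable {V : Type*} [NormedAddCommGroup V] [InnerProductSpace ℝ V] [FiniteDimensional ℝ V]
  [MeasurableSpace V] [BorelSpace V]

lemma integrable_norm_sq_stdGaussian : Integrable (fun x : V => ‖x‖ ^ 2) (stdGaussian V) :=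
  (memLp_two_iff_integrable_sq_norm (by fun_prop)).1 (IsGaussian.memLp_two_id (μ := stdGaussian V))

lemma integral_inner_sq_stdGaussian (g : V) :
    ∫ y, ⟪g, y⟫ ^ 2 ∂(stdGaussian V) = ‖g‖ ^ 2 := by
  have h := variance_dual_stdGaussian (innerSL ℝ g : StrongDual ℝ V)
  rw [variance_of_integral_eq_zero (by fun_prop) (integral_strongDual_stdGaussian _)] at h
  simpa using h

lemma integrable_prod_stdGaussian {f : V × V → ℝ} (hf : Measurable f) (C : ℝ)
    (h : ∀ p, |f p| ≤ C * (‖p.1‖ ^ 2 + ‖p.2‖ ^ 2)) :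
    Integrable f ((stdGaussian V).prod (stdGaussian V)) := by
  have h1 : Integrable (fun p : V × V => C * (‖p.1‖ ^ 2 + ‖p.2‖ ^ 2))
      ((stdGaussian V).prod (stdGaussian V)) :=
    ((integrable_norm_sq_stdGaussian.comp_fst _).add
      (integrable_norm_sq_stdGaussian.comp_snd _)).const_mul C
  exact h1.mono' hf.aestronglyMeasurable (ae_of_all _ h)

/-- Integrals against a product of standard Gaussian measures are invariant under rotations. -/
lemma integral_rotation_stdGaussian {f : V × V → ℝ} (hf : Measurable f) (θ : ℝ) :
    ∫ p, f (Real.cos θ • p.1 + Real.sin θ • p.2, -Real.sin θ • p.1 + Real.cos θ • p.2)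
      ∂((stdGaussian V).prod (stdGaussian V)) =
    ∫ p, f p ∂((stdGaussian V).prod (stdGaussian V)) := by
  have h := IsGaussian.map_rotation_eq_self (μ := stdGaussian V)
    (by simp) θ
  conv_rhs => rw [← h]
  rw [integral_map (by fun_prop) hf.aestronglyMeasurable]
  rfl

lemma integral_inner_gradient_sq_le {G : V → V} (hG : Measurable G) (hG1 : ∀ x, ‖G x‖ ≤ 1)
    (a b : ℝ) :
    ∫ p, ⟪G p.1, a • p.1 + b • p.2⟫ ^ 2 ∂((stdGaussian V).prod (stdGaussian V)) ≤
      2 * a ^ 2 * (∫ x, ‖x‖ ^ 2 ∂(stdGaussian V)) + 2 * b ^ 2 := by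
  have hin : ∀ x y : V, ⟪G x, y⟫ ^ 2 ≤ ‖y‖ ^ 2 := fun x y => by
    rw [← sq_abs]
    gcongr
    calc |⟪G x, y⟫| ≤ ‖G x‖ * ‖y‖ := abs_real_inner_le_norm _ _
      _ ≤ 1 * ‖y‖ := by gcongr; exact hG1 x
      _ = ‖y‖ := one_mul _
  have hint2 : Integrable (fun p : V × V => ⟪G p.1, p.2⟫ ^ 2)
      ((stdGaussian V).prod (stdGaussian V)) := by
    refine integrable_prod_stdGaussian (by fun_prop) 1 fun p => ?_
    rw [abs_of_nonneg (sq_nonneg _)]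
    nlinarith [hin p.1 p.2, sq_nonneg ‖p.1‖]
  have hbound : ∀ p : V × V, ⟪G p.1, a • p.1 + b • p.2⟫ ^ 2 ≤
      2 * a ^ 2 * ‖p.1‖ ^ 2 + 2 * b ^ 2 * ⟪G p.1, p.2⟫ ^ 2 := fun p => by
    rw [inner_add_right, real_inner_smul_right, real_inner_smul_right]
    nlinarith [hin p.1 p.1, sq_nonneg (a * ⟪G p.1, p.1⟫ - b * ⟪G p.1, p.2⟫), sq_nonneg a,
      mul_le_mul_of_nonneg_left (hin p.1 p.1) (sq_nonneg a)]
  have hint1 := (integrable_norm_sq_stdGaussian (V := V)).comp_fst (stdGaussian V)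
  calc _ ≤ ∫ p : V × V, (2 * a ^ 2 * ‖p.1‖ ^ 2 + 2 * b ^ 2 * ⟪G p.1, p.2⟫ ^ 2)
        ∂((stdGaussian V).prod (stdGaussian V)) := by
        refine integral_mono ?_ ((hint1.const_mul _).add (hint2.const_mul _)) hbound
        refine integrable_prod_stdGaussian (by fun_prop) (2 * a ^ 2 + 2 * b ^ 2) fun p => ?_
        rw [abs_of_nonneg (sq_nonneg _)]
        refine (hbound p).trans ?_
        nlinarith [mul_le_mul_of_nonneg_left (hin p.1 p.2) (sq_nonneg b), sq_nonneg (a * ‖p.2‖),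
          sq_nonneg (b * ‖p.1‖)]
    _ = 2 * a ^ 2 * (∫ x, ‖x‖ ^ 2 ∂(stdGaussian V)) + 2 * b ^ 2 *
        ∫ p : V × V, ⟪G p.1, p.2⟫ ^ 2 ∂((stdGaussian V).prod (stdGaussian V)) := by
        rw [integral_add (hint1.const_mul _) (hint2.const_mul _), integral_const_mul,
          integral_const_mul, integral_fun_fst (fun x : V => ‖x‖ ^ 2)]
        simp
    _ ≤ _ := by
        have h1 : ∀ x, ‖G x‖ ^ 2 ≤ 1 := fun x => by
          nlinarith [hG1 x, norm_nonneg (G x)]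
        have h2 : ∫ p : V × V, ⟪G p.1, p.2⟫ ^ 2 ∂((stdGaussian V).prod (stdGaussian V)) ≤ 1 := by
          rw [integral_prod _ hint2]
          simp only [integral_inner_sq_stdGaussian]
          calc ∫ x, ‖G x‖ ^ 2 ∂(stdGaussian V)
              ≤ ∫ x, (1 : ℝ) ∂(stdGaussian V) :=
                integral_mono_of_nonneg (ae_of_all _ fun x => sq_nonneg _)
                  (integrable_const _) (ae_of_all _ h1)
            _ = 1 := by simp
        nlinarith [mul_le_mul_of_nonneg_left h2 (sq_nonneg b)]

lemma integral_sub_rotation_sq_le {F : V → ℝ} {G : V → V} (hF : Measurable F)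
    (hG : Measurable G) (hG1 : ∀ x, ‖G x‖ ≤ 1) (hsub : ∀ x y, F x + ⟪G x, y - x⟫ ≤ F y)
    (δ : ℝ) :
    ∫ p, (F (Real.cos δ • p.1 + Real.sin δ • p.2) - F p.1) ^ 2
      ∂((stdGaussian V).prod (stdGaussian V)) ≤
      δ ^ 4 * (∫ x, ‖x‖ ^ 2 ∂(stdGaussian V)) + 4 * δ ^ 2 := by
  set c := Real.cos δ
  set s := Real.sin δ
  have hcs : c ^ 2 + s ^ 2 = 1 := Real.cos_sq_add_sin_sq δ
  have hm : 0 ≤ ∫ x, ‖x‖ ^ 2 ∂(stdGaussian V) := integral_nonneg fun x => by positivity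
  have hcross : ∀ a b : ℝ, ∀ x y : V, ‖a • x + b • y‖ ^ 2 ≤
      2 * (a ^ 2 + b ^ 2) * (‖x‖ ^ 2 + ‖y‖ ^ 2) := fun a b x y => by
    have h1 : ‖a • x + b • y‖ ≤ |a| * ‖x‖ + |b| * ‖y‖ := by
      refine (norm_add_le _ _).trans ?_
      rw [norm_smul, norm_smul, Real.norm_eq_abs, Real.norm_eq_abs]
    have h2 : ‖a • x + b • y‖ ^ 2 ≤ (|a| * ‖x‖ + |b| * ‖y‖) ^ 2 := by gcongr
    nlinarith [sq_nonneg (|a| * ‖x‖ - |b| * ‖y‖), sq_abs a, sq_abs b, sq_nonneg (|a| * ‖y‖),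
      sq_nonneg (|b| * ‖x‖)]
  have hinb : ∀ w y : V, ⟪G w, y⟫ ^ 2 ≤ ‖y‖ ^ 2 := fun x y => by
    rw [← sq_abs]
    gcongr
    calc |⟪G x, y⟫| ≤ ‖G x‖ * ‖y‖ := abs_real_inner_le_norm _ _
      _ ≤ 1 * ‖y‖ := by gcongr; exact hG1 x
      _ = ‖y‖ := one_mul _
  have hI1 : Integrable (fun p : V × V => ⟪G p.1, (c - 1) • p.1 + s • p.2⟫ ^ 2)
      ((stdGaussian V).prod (stdGaussian V)) := by
    refine integrable_prod_stdGaussian (by fun_prop) (2 * ((c - 1) ^ 2 + s ^ 2)) fun p => ?_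
    rw [abs_of_nonneg (sq_nonneg _)]
    exact (hinb _ _).trans (hcross _ _ _ _)
  have hI2 : Integrable (fun p : V × V =>
      ⟪G (c • p.1 + s • p.2), (c - 1) • p.1 + s • p.2⟫ ^ 2)
      ((stdGaussian V).prod (stdGaussian V)) := by
    refine integrable_prod_stdGaussian (by fun_prop) (2 * ((c - 1) ^ 2 + s ^ 2)) fun p => ?_
    rw [abs_of_nonneg (sq_nonneg _)]
    exact (hinb _ _).trans (hcross _ _ _ _)
  have hdiff : ∀ p : V × V, c • p.1 + s • p.2 - p.1 = (c - 1) • p.1 + s • p.2 := fun p => by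
    module
  have hI0 : Integrable (fun p : V × V => (F (c • p.1 + s • p.2) - F p.1) ^ 2)
      ((stdGaussian V).prod (stdGaussian V)) := by
    refine integrable_prod_stdGaussian (by fun_prop) (2 * ((c - 1) ^ 2 + s ^ 2)) fun p => ?_
    rw [abs_of_nonneg (sq_nonneg _), ← sq_abs]
    refine le_trans ?_ (hcross _ _ _ _)
    rw [← hdiff]
    gcongr
    exact abs_sub_le_of_subgradient hG1 hsub _ _
  have hpt : ∀ p : V × V, (F (c • p.1 + s • p.2) - F p.1) ^ 2 ≤
      ⟪G p.1, (c - 1) • p.1 + s • p.2⟫ ^ 2 +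
        ⟪G (c • p.1 + s • p.2), (c - 1) • p.1 + s • p.2⟫ ^ 2 := fun p => by
    have h1 := hsub p.1 (c • p.1 + s • p.2)
    have h2 := hsub (c • p.1 + s • p.2) p.1
    rw [hdiff] at h1
    rw [← neg_sub, hdiff, inner_neg_right] at h2
    rcases le_total 0 (F (c • p.1 + s • p.2) - F p.1) with h | h <;> nlinarith [
      sq_nonneg ⟪G p.1, (c - 1) • p.1 + s • p.2⟫,
      sq_nonneg ⟪G (c • p.1 + s • p.2), (c - 1) • p.1 + s • p.2⟫]
  have hrot : ∫ p : V × V, ⟪G (c • p.1 + s • p.2), (c - 1) • p.1 + s • p.2⟫ ^ 2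
      ∂((stdGaussian V).prod (stdGaussian V)) =
      ∫ p : V × V, ⟪G p.1, (1 - c) • p.1 + s • p.2⟫ ^ 2
        ∂((stdGaussian V).prod (stdGaussian V)) := by
    rw [← integral_rotation_stdGaussian
      (f := fun p : V × V => ⟪G p.1, (1 - c) • p.1 + s • p.2⟫ ^ 2) (by fun_prop) δ]
    congr 1
    ext p
    congr 2
    change _ = (1 - c) • (c • p.1 + s • p.2) + s • (-s • p.1 + c • p.2)
    have : s ^ 2 = 1 - c ^ 2 := by linarith
    match_scalars
    · linear_combination hcs
    · ring
  have hc1 : (1 - c) ^ 2 ≤ (δ ^ 2 / 2) ^ 2 := by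
    have h1 : 1 - δ ^ 2 / 2 ≤ c := Real.one_sub_sq_div_two_le_cos
    have h2 : c ≤ 1 := Real.cos_le_one δ
    apply pow_le_pow_left₀ <;> linarith
  have hs1 : s ^ 2 ≤ δ ^ 2 := Real.sin_sq_le_sq
  calc _ ≤ ∫ p : V × V, (⟪G p.1, (c - 1) • p.1 + s • p.2⟫ ^ 2 +
        ⟪G (c • p.1 + s • p.2), (c - 1) • p.1 + s • p.2⟫ ^ 2)
        ∂((stdGaussian V).prod (stdGaussian V)) := integral_mono hI0 (hI1.add hI2) hpt
    _ ≤ _ := by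
        rw [integral_add hI1 hI2, hrot]
        have h1 := integral_inner_gradient_sq_le hG hG1 (c - 1) s
        have h2 := integral_inner_gradient_sq_le hG hG1 (1 - c) s
        have h3 := mul_le_mul_of_nonneg_right hc1 hm
        nlinarith

/-- A function on a Gaussian space with a subgradient of norm at most one has variance bounded
independently of the dimension. -/
theorem variance_stdGaussian_le_of_subgradient {F : V → ℝ} {G : V → V} (hF : Measurable F)
    (hG : Measurable G) (hG1 : ∀ x, ‖G x‖ ≤ 1) (hsub : ∀ x y, F x + ⟪G x, y - x⟫ ≤ F y) :
    MemLp F 2 (stdGaussian V) ∧ Var[F; stdGaussian V] ≤ 8 := by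
  have hLip := abs_sub_le_of_subgradient hG1 hsub
  have hmem : MemLp F 2 (stdGaussian V) := by
    have h1 : MemLp (fun x : V => ‖x‖ + |F 0|) 2 (stdGaussian V) :=
      (IsGaussian.memLp_two_id (μ := stdGaussian V)).norm.add (memLp_const _)
    refine h1.mono' hF.aestronglyMeasurable (ae_of_all _ fun x => ?_)
    have := hLip 0 x
    rw [sub_zero] at this
    rw [Real.norm_eq_abs]
    have h3 := abs_add_le (F x - F 0) (F 0)
    rw [sub_add_cancel] at h3
    linarith
  refine ⟨hmem, ?_⟩
  set m := ∫ x, ‖x‖ ^ 2 ∂(stdGaussian V) with hm_def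
  have hm : 0 ≤ m := integral_nonneg fun x => by positivity
  have key : ∀ N : ℕ, 0 < N → ∫ p : V × V, (F p.2 - F p.1) ^ 2
      ∂((stdGaussian V).prod (stdGaussian V)) ≤
      (Real.pi / 2) ^ 2 * (4 + (Real.pi / 2 / N) ^ 2 * m) := by
    intro N hN
    set δ := Real.pi / 2 / N
    let R : ℕ → V × V → V := fun i p => Real.cos (i * δ) • p.1 + Real.sin (i * δ) • p.2
    have hRm : ∀ i, Measurable (R i) := fun i => by fun_prop
    have hR0 : ∀ p, R 0 p = p.1 := fun p => by simp [R]
    have hNδ : (N : ℝ) * δ = Real.pi / 2 := by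
      have : (N : ℝ) ≠ 0 := by positivity
      simp only [δ]; field_simp
    have hRN : ∀ p, R N p = p.2 := fun p => by simp [R, hNδ]
    have hRle : ∀ i p, ‖R i p‖ ≤ ‖p.1‖ + ‖p.2‖ := fun i p => by
      refine (norm_add_le _ _).trans ?_
      rw [norm_smul, norm_smul, Real.norm_eq_abs, Real.norm_eq_abs]
      nlinarith [Real.abs_cos_le_one (i * δ), Real.abs_sin_le_one (i * δ), norm_nonneg p.1,
        norm_nonneg p.2]
    have hstep : ∀ i, ∫ p : V × V, (F (R (i + 1) p) - F (R i p)) ^ 2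
        ∂((stdGaussian V).prod (stdGaussian V)) ≤ δ ^ 4 * m + 4 * δ ^ 2 := by
      intro i
      refine le_trans (le_of_eq ?_) (integral_sub_rotation_sq_le hF hG hG1 hsub δ)
      rw [← integral_rotation_stdGaussian (f := fun p : V × V =>
        (F (Real.cos δ • p.1 + Real.sin δ • p.2) - F p.1) ^ 2) (by fun_prop) (i * δ)]
      congr 1
      ext p
      simp only [R]
      congr 3
      push_cast
      rw [add_mul, one_mul, Real.cos_add, Real.sin_add]
      module
    have hint : ∀ i, Integrable (fun p : V × V => (F (R (i + 1) p) - F (R i p)) ^ 2)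
        ((stdGaussian V).prod (stdGaussian V)) := by
      intro i
      refine integrable_prod_stdGaussian (by fun_prop) 8 fun p => ?_
      rw [abs_of_nonneg (sq_nonneg _), ← sq_abs]
      have h1 := hLip (R i p) (R (i + 1) p)
      have h2 := norm_sub_le (R (i + 1) p) (R i p)
      have h3 : |F (R (i + 1) p) - F (R i p)| ≤ 2 * (‖p.1‖ + ‖p.2‖) := by
        linarith [hRle i p, hRle (i + 1) p]
      have h4 : |F (R (i + 1) p) - F (R i p)| ^ 2 ≤ (2 * (‖p.1‖ + ‖p.2‖)) ^ 2 := by gcongr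
      nlinarith [sq_nonneg (‖p.1‖ - ‖p.2‖)]
    have hpt : ∀ p : V × V, (F p.2 - F p.1) ^ 2 ≤
        N * ∑ i ∈ Finset.range N, (F (R (i + 1) p) - F (R i p)) ^ 2 := by
      intro p
      have h1 := sq_sum_le_card_mul_sum_sq (s := Finset.range N)
        (f := fun i => F (R (i + 1) p) - F (R i p))
      rwa [Finset.sum_range_sub (fun i => F (R i p)), hRN, hR0, Finset.card_range] at h1
    calc _ ≤ ∫ p : V × V, N * ∑ i ∈ Finset.range N, (F (R (i + 1) p) - F (R i p)) ^ 2
          ∂((stdGaussian V).prod (stdGaussian V)) := by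
          refine integral_mono_of_nonneg (ae_of_all _ fun p => sq_nonneg _)
            ((integrable_finsetSum _ fun i _ => hint i).const_mul _) (ae_of_all _ hpt)
      _ = N * ∑ i ∈ Finset.range N, ∫ p : V × V, (F (R (i + 1) p) - F (R i p)) ^ 2
          ∂((stdGaussian V).prod (stdGaussian V)) := by
          rw [integral_const_mul, integral_finsetSum _ fun i _ => hint i]
      _ ≤ N * ∑ i ∈ Finset.range N, (δ ^ 4 * m + 4 * δ ^ 2) := by
          gcongr with i _
          exact hstep i
      _ = (N * δ) ^ 2 * (4 + δ ^ 2 * m) := by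
          simp only [Finset.sum_const, Finset.card_range, nsmul_eq_mul]; ring
      _ = _ := by rw [hNδ]
  have hlim : Tendsto (fun N : ℕ => (Real.pi / 2) ^ 2 * (4 + (Real.pi / 2 / N) ^ 2 * m)) atTop
      (𝓝 ((Real.pi / 2) ^ 2 * (4 + 0 ^ 2 * m))) :=
    ((((tendsto_const_div_atTop_nhds_zero_nat (Real.pi / 2)).pow 2).mul_const m).const_add
      4).const_mul _
  have hle : ∫ p : V × V, (F p.2 - F p.1) ^ 2 ∂((stdGaussian V).prod (stdGaussian V)) ≤
      (Real.pi / 2) ^ 2 * (4 + 0 ^ 2 * m) :=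
    ge_of_tendsto hlim (eventually_atTop.2 ⟨1, fun N hN => key N hN⟩)
  have hF1 : Integrable F (stdGaussian V) := hmem.integrable (by norm_num)
  have hF2 : Integrable (fun x => F x ^ 2) (stdGaussian V) := hmem.integrable_sq
  have hexp : ∫ p : V × V, (F p.2 - F p.1) ^ 2 ∂((stdGaussian V).prod (stdGaussian V)) =
      2 * Var[F; stdGaussian V] := by
    have hsplit : ∀ p : V × V, (F p.2 - F p.1) ^ 2 =
        (F p.2 ^ 2 + F p.1 ^ 2) - 2 * (F p.1 * F p.2) := fun p => by ring
    have hsum : Integrable (fun p : V × V => F p.2 ^ 2 + F p.1 ^ 2)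
        ((stdGaussian V).prod (stdGaussian V)) := (hF2.comp_snd _).add (hF2.comp_fst _)
    simp_rw [hsplit]
    rw [integral_sub hsum ((hF1.mul_prod hF1).const_mul 2),
      integral_add (hF2.comp_snd _) (hF2.comp_fst _), integral_const_mul, integral_prod_mul,
      integral_fun_fst (fun x : V => F x ^ 2), integral_fun_snd (fun x : V => F x ^ 2),
      variance_eq_sub hmem]
    simp
    ring
  have hpi := Real.pi_lt_four
  have hpi0 := Real.pi_pos
  nlinarith [Real.pi_lt_d2]

end Gaussian

section LowerBound

variable {X : Type*} [NormedAddCommGroup X] [NormedSpace ℝ X]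

lemma gaussianReal_le_abs_pos (t : ℝ) : 0 < (gaussianReal 0 1).real {x | t ≤ |x|} := by
  have h0 : (gaussianReal 0 1) {x | t ≤ |x|} ≠ 0 := by
    intro h
    have h1 := gaussianReal_absolutelyContinuous' 0 (v := 1) one_ne_zero h
    have h2 : Set.Ici t ⊆ {x : ℝ | t ≤ |x|} := fun x hx => le_trans hx (le_abs_self x)
    have h3 := measure_mono_null h2 h1
    simp at h3
  exact ENNReal.toReal_pos h0 (measure_ne_top _ _)

lemma integrable_norm_sum_pi_gaussianReal {m : ℕ} (x : Fin m → X) :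
    Integrable (fun v : Fin m → ℝ => ‖∑ i, v i • x i‖)
      (Measure.pi fun _ => gaussianReal 0 1) := by
  have h : Integrable (fun v : Fin m → ℝ => ∑ i, |v i| * ‖x i‖)
      (Measure.pi fun _ => gaussianReal 0 1) :=
    integrable_finsetSum _ fun i _ =>
      ((integrable_eval (μ := fun _ : Fin m => gaussianReal 0 1) (i := i)
        IsGaussian.integrable_id).abs).mul_const _
  refine h.mono' (Continuous.aestronglyMeasurable (by fun_prop)) (ae_of_all _ fun v => ?_)
  rw [norm_norm]
  refine (norm_sum_le _ _).trans (le_of_eq ?_)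
  simp [norm_smul]

/-- On an event that is symmetric in every coordinate, the norm of a Gaussian sum dominates the
norm of each of its terms. -/
lemma mul_le_setIntegral_norm_sum {m : ℕ} (x : Fin m → X) {c t : ℝ} (ht : 0 ≤ t)
    (hx : ∀ i, c ≤ ‖x i‖) (i : Fin m) (B : Fin m → Set ℝ) (hB : ∀ j, MeasurableSet (B j))
    (hBneg : ∀ j y, -y ∈ B j ↔ y ∈ B j) (hBi : ∀ y ∈ B i, t ≤ |y|) :
    c * t * (Measure.pi fun _ => gaussianReal 0 1).real (Set.univ.pi B) ≤
      ∫ v in Set.univ.pi B, ‖∑ i, v i • x i‖ ∂(Measure.pi fun _ => gaussianReal 0 1) := by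
  set P : Measure (Fin m → ℝ) := Measure.pi fun _ => gaussianReal 0 1
  have hint := integrable_norm_sum_pi_gaussianReal x
  set σ : Fin m → ℝ → ℝ := fun j y => if j = i then y else -y
  let τ : (Fin m → ℝ) → (Fin m → ℝ) := fun v j => σ j (v j)
  have hτ : MeasurePreserving τ P P := by
    refine measurePreserving_pi _ _ fun j => ?_
    by_cases hj : j = i
    · simp only [σ, hj, if_true]
      exact MeasurePreserving.id _
    · simp only [σ, hj, if_false]
      exact ⟨measurable_neg, by simpa using gaussianReal_map_neg (μ := 0) (v := 1)⟩
  have hBm : MeasurableSet (Set.univ.pi B) := MeasurableSet.univ_pi hB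
  have hpre : τ ⁻¹' (Set.univ.pi B) = Set.univ.pi B := by
    ext v
    simp only [Set.mem_preimage, Set.mem_univ_pi, τ]
    refine forall_congr' fun j => ?_
    by_cases hj : j = i
    · simp [σ, hj]
    · simp [σ, hj, hBneg]
  have hflip : ∫ v in Set.univ.pi B, ‖∑ i, τ v i • x i‖ ∂P =
      ∫ v in Set.univ.pi B, ‖∑ i, v i • x i‖ ∂P := by
    have hτe : MeasurableEmbedding τ := by
      have hinv : Function.Involutive τ := fun v => by
        ext j
        by_cases hj : j = i <;> simp [τ, σ, hj]
      exact (MeasurableEquiv.ofInvolutive τ hinv hτ.measurable).measurableEmbedding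
    conv_lhs => rw [← hpre]
    exact hτ.setIntegral_preimage_emb hτe (fun v => ‖∑ i, v i • x i‖) _
  have hintτ : Integrable (fun v => ‖∑ i, τ v i • x i‖) P := hτ.integrable_comp_of_integrable hint
  have hpt : ∀ v ∈ Set.univ.pi B, 2 * (c * t) ≤ ‖∑ i, v i • x i‖ + ‖∑ i, τ v i • x i‖ := by
    intro v hv
    have hsum : ∑ i, v i • x i + ∑ i, τ v i • x i = (2 * v i) • x i := by
      rw [← Finset.sum_add_distrib, Finset.sum_eq_single i]
      · simp [τ, σ, two_mul, add_smul]
      · intro j _ hj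
        simp [τ, σ, hj]
      · simp
    have h1 := norm_add_le (∑ i, v i • x i) (∑ i, τ v i • x i)
    rw [hsum, norm_smul, Real.norm_eq_abs, abs_mul, abs_two] at h1
    have h2 := hBi _ (hv i (Set.mem_univ i))
    have h3 := hx i
    have h4 : c * t ≤ ‖x i‖ * |v i| := mul_le_mul h3 h2 ht (norm_nonneg _)
    linarith
  have h := setIntegral_mono_on (μ := P) (integrableOn_const (C := 2 * (c * t)) (by simp))
    (hint.add hintτ).integrableOn hBm hpt
  rw [setIntegral_const, smul_eq_mul] at h
  have hadd : ∫ v in Set.univ.pi B, (fun v => ‖∑ i, v i • x i‖ + ‖∑ i, τ v i • x i‖) v ∂P =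
      ∫ v in Set.univ.pi B, ‖∑ i, v i • x i‖ ∂P + ∫ v in Set.univ.pi B, ‖∑ i, τ v i • x i‖ ∂P :=
    integral_add hint.integrableOn hintτ.integrableOn
  change P.real (Set.univ.pi B) * _ ≤ ∫ v in Set.univ.pi B, (fun v => ‖∑ i, v i • x i‖ +
    ‖∑ i, τ v i • x i‖) v ∂P at h
  rw [hadd, hflip] at h
  linarith

/-- Gaussian averages of sufficiently many vectors bounded away from zero are large. -/
theorem exists_le_integral_norm_sum_gaussian (X : Type*) [NormedAddCommGroup X] [NormedSpace ℝ X]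
    {c t : ℝ} (hc : 0 ≤ c) (ht : 0 ≤ t) :
    ∃ m : ℕ, ∀ x : Fin m → X, (∀ i, c ≤ ‖x i‖) →
      c * t / 4 ≤ ∫ v, ‖∑ i, v i • x i‖ ∂(stdGaussian (EuclideanSpace ℝ (Fin m))) := by
  set p := (gaussianReal 0 1).real {x | t ≤ |x|} with hp_def
  have hp : 0 < p := gaussianReal_le_abs_pos t
  have hp1 : p ≤ 1 := measureReal_le_one
  set m := ⌈1 / (2 * p)⌉₊
  have hm1 : 1 / 2 ≤ m * p := by
    have h1 : 1 / (2 * p) ≤ m := Nat.le_ceil _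
    rw [div_le_iff₀ (by positivity)] at h1
    linarith
  have hm0 : 0 < m := Nat.ceil_pos.2 (by positivity)
  have hm2 : ((m - 1 : ℕ) : ℝ) * p ≤ 1 / 2 := by
    have h1 : (m : ℝ) < 1 / (2 * p) + 1 := Nat.ceil_lt_add_one (by positivity)
    rw [Nat.cast_sub hm0]
    push_cast
    have h2 : (m : ℝ) - 1 < 1 / (2 * p) := by linarith
    rw [lt_div_iff₀ (by positivity)] at h2
    linarith
  refine ⟨m, fun x hx => ?_⟩
  rw [← map_pi_eq_stdGaussian, integral_map (by fun_prop)
    (Continuous.aestronglyMeasurable (by fun_prop))]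
  change _ ≤ ∫ v : Fin m → ℝ, ‖∑ i, v i • x i‖ ∂(Measure.pi fun _ => gaussianReal 0 1)
  set P : Measure (Fin m → ℝ) := Measure.pi fun _ => gaussianReal 0 1
  let B : Fin m → Fin m → Set ℝ := fun i j => if j = i then {y | t ≤ |y|} else {y | t ≤ |y|}ᶜ
  have hSm : MeasurableSet {y : ℝ | t ≤ |y|} := measurableSet_le measurable_const (by fun_prop)
  have hBm : ∀ i j, MeasurableSet (B i j) := fun i j => by
    by_cases hj : j = i
    · simpa [B, hj] using hSm
    · simpa [B, hj] using hSm.compl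
  have hprob : ∀ i, 1 / (2 : ℝ) * p ≤ P.real (Set.univ.pi (B i)) := by
    intro i
    have h1 : P.real (Set.univ.pi (B i)) = p * (1 - p) ^ (m - 1) := by
      rw [measureReal_def, Measure.pi_pi, ENNReal.toReal_prod,
        ← Finset.mul_prod_erase _ _ (Finset.mem_univ i)]
      congr 1
      · simp [B, hp_def, measureReal_def]
      · rw [Finset.prod_congr rfl (g := fun _ => 1 - p), Finset.prod_const,
          Finset.card_erase_of_mem (Finset.mem_univ i), Finset.card_univ, Fintype.card_fin]
        intro j hj
        have hj' : j ≠ i := (Finset.mem_erase.1 hj).1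
        simp only [B, hj', if_false]
        rw [← measureReal_def, probReal_compl_eq_one_sub hSm]
    rw [h1]
    have h2 := one_add_mul_le_pow (a := -p) (by linarith) (m - 1)
    rw [← sub_eq_add_neg] at h2
    nlinarith
  have hdisj : Pairwise (Function.onFun Disjoint fun i => Set.univ.pi (B i)) := by
    intro i j hij
    rw [Function.onFun, Set.disjoint_left]
    intro v hv hv'
    have h1 := hv i (Set.mem_univ i)
    have h2 := hv' i (Set.mem_univ i)
    simp only [B, if_true, hij, if_false] at h1 h2
    exact h2 h1
  have hint := integrable_norm_sum_pi_gaussianReal x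
  calc c * t / 4 ≤ ∑ i : Fin m, c * t * (1 / 2 * p) := by
        rw [Finset.sum_const, Finset.card_univ, Fintype.card_fin, nsmul_eq_mul]
        nlinarith [mul_nonneg hc ht]
    _ ≤ ∑ i, ∫ v in Set.univ.pi (B i), ‖∑ i, v i • x i‖ ∂P := by
        refine Finset.sum_le_sum fun i _ => ?_
        refine (mul_le_mul_of_nonneg_left (hprob i) (mul_nonneg hc ht)).trans ?_
        refine mul_le_setIntegral_norm_sum x ht hx i (B i) (hBm i) (fun j y => ?_) fun y hy => ?_
        · by_cases hj : j = i <;> simp [B, hj]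
        · simpa [B] using hy
    _ = ∫ v in ⋃ i, Set.univ.pi (B i), ‖∑ i, v i • x i‖ ∂P :=
        (integral_iUnion_fintype (fun i => MeasurableSet.univ_pi (hBm i)) hdisj
          fun i => hint.integrableOn).symm
    _ ≤ _ := setIntegral_le_integral hint (ae_of_all _ fun v => norm_nonneg _)

end LowerBound

section DvoretzkyRogers

lemma det_add_starProjection {V : Type*} [NormedAddCommGroup V] [InnerProductSpace ℝ V]
    [FiniteDimensional ℝ V] (U : Submodule ℝ V) :
    LinearMap.det (LinearMap.id + U.starProjection.toLinearMap : V →ₗ[ℝ] V) =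
      2 ^ Module.finrank ℝ U := by
  set e : V →ₗ[ℝ] V := LinearMap.id + U.starProjection.toLinearMap
  have he2 : ∀ x ∈ U, e x = (2 : ℝ) • x := fun x hx => by
    simp [e, Submodule.starProjection_eq_self_iff.2 hx, two_smul]
  have he : U ≤ U.comap e := fun x hx => by
    rw [Submodule.mem_comap, he2 x hx]
    exact U.smul_mem _ hx
  rw [LinearMap.det_eq_det_mul_det U e he]
  have h1 : e.restrict he = (2 : ℝ) • LinearMap.id := by
    ext x
    simp [LinearMap.restrict_apply, he2 x x.2]
  have h2 : U.mapQ U e he = LinearMap.id := by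
    ext x
    simp [e]
  rw [h1, h2]
  simp

lemma exists_isometry_of_orthonormal {V : Type*} [NormedAddCommGroup V] [InnerProductSpace ℝ V]
    {m : ℕ} {e : Fin m → V} (he : Orthonormal ℝ e) :
    ∃ T : EuclideanSpace ℝ (Fin m) →L[ℝ] V, (∀ v, T v = ∑ i, v i • e i) ∧ ∀ v, ‖T v‖ = ‖v‖ := by
  let T : EuclideanSpace ℝ (Fin m) →ₗ[ℝ] V :=
    (Fintype.linearCombination ℝ e) ∘ₗ (WithLp.linearEquiv 2 ℝ (Fin m → ℝ)).toLinearMap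
  have hT : ∀ v, T v = ∑ i, v i • e i := fun v => by
    simp [T, Fintype.linearCombination_apply]
  refine ⟨T.toContinuousLinearMap, hT, fun v => ?_⟩
  change ‖T v‖ = ‖v‖
  rw [← sq_eq_sq₀ (norm_nonneg _) (norm_nonneg _), EuclideanSpace.real_norm_sq_eq v,
    ← real_inner_self_eq_norm_sq (T v), hT, he.inner_sum]
  simp [sq]

variable {X : Type*} [NormedAddCommGroup X] [NormedSpace ℝ X]

lemma exists_injective_of_not_finiteDimensional (h : ¬ FiniteDimensional ℝ X) (N : ℕ) :
    ∃ b : EuclideanSpace ℝ (Fin N) →L[ℝ] X, Function.Injective b := by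
  have h1 : Cardinal.aleph0 ≤ Module.rank ℝ X := by
    by_contra! hlt
    exact h (Module.rank_lt_aleph0_iff.1 hlt)
  have h2 : (N : Cardinal) ≤ Module.rank ℝ X := (Cardinal.natCast_le_aleph0).trans h1
  obtain ⟨f, hf⟩ := Module.le_rank_iff_exists_linearMap.1 h2
  refine ⟨(f ∘ₗ (WithLp.linearEquiv 2 ℝ (Fin N → ℝ)).toLinearMap).toContinuousLinearMap, ?_⟩
  exact hf.comp (WithLp.linearEquiv 2 ℝ (Fin N → ℝ)).injective

/-- An operator of maximal determinant into an infinite-dimensional space is large on every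
subspace of large dimension. -/
lemma exists_norm_ge_of_finrank_ge (h : ¬ FiniteDimensional ℝ X) (m : ℕ) :
    ∃ u : EuclideanSpace ℝ (Fin (2 * m)) →L[ℝ] X, ‖u‖ ≤ 1 ∧
      ∀ U : Submodule ℝ (EuclideanSpace ℝ (Fin (2 * m))), m ≤ Module.finrank ℝ U → 0 < m →
        ∃ w ∈ U, ‖w‖ = 1 ∧ 2 / 5 ≤ ‖u w‖ := by
  obtain ⟨b, hb⟩ := exists_injective_of_not_finiteDimensional h (2 * m)
  set V := EuclideanSpace ℝ (Fin (2 * m))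
  obtain ⟨k, hk0, hk⟩ := b.toLinearMap.exists_antilipschitzWith (LinearMap.ker_eq_bot.2 hb)
  have hk' : ∀ v, ‖v‖ ≤ k * ‖b v‖ := fun v => by
    have := hk.le_mul_dist v 0
    simpa using this
  let K : Set (V →L[ℝ] V) := {A | ‖b.comp A‖ ≤ 1}
  have hK : IsCompact K := by
    refine Metric.isCompact_of_isClosed_isBounded ?_ ?_
    · exact isClosed_le ((ContinuousLinearMap.compL ℝ V V X b).continuous.norm) continuous_const
    · refine isBounded_iff_forall_norm_le.2 ⟨k, fun A hA => ?_⟩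
      refine A.opNorm_le_bound k.2 fun v => (hk' _).trans ?_
      gcongr
      have := (b.comp A).le_of_opNorm_le hA v
      simpa using this
  obtain ⟨A, hAK, hA⟩ := hK.exists_isMaxOn ⟨0, by simp [K]⟩
    (ContinuousLinearMap.continuous_det (𝕜 := ℝ) (E := V)).abs.continuousOn
  have hdet : ∀ A' : V →L[ℝ] V, A' ∈ K → |A'.det| ≤ |A.det| := fun A' hA' => hA hA'
  have hscale : ∀ (A' : V →L[ℝ] V) (r : ℝ), (r • A').det = r ^ (2 * m) * A'.det := fun A' r => by
    have : (r • A').det = LinearMap.det (r • A'.toLinearMap) := rfl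
    rw [this, LinearMap.det_smul]
    simp [V]
  have hA0 : 0 < |A.det| := by
    have hpos : 0 < ‖b‖ + 1 := by positivity
    refine lt_of_lt_of_le ?_ (hdet ((‖b‖ + 1)⁻¹ • ContinuousLinearMap.id ℝ V) ?_)
    · rw [hscale, abs_pos]
      have : (ContinuousLinearMap.id ℝ V).det = 1 := LinearMap.det_id
      rw [this, mul_one]
      positivity
    · change ‖b.comp _‖ ≤ 1
      rw [ContinuousLinearMap.comp_smul, norm_smul, ContinuousLinearMap.comp_id, norm_inv,
        Real.norm_of_nonneg hpos.le, inv_mul_le_one₀ hpos]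
      linarith
  refine ⟨b.comp A, hAK, fun U hU hm => ?_⟩
  by_contra! hcon
  have hsmall : ∀ w ∈ U, ‖b.comp A w‖ ≤ 2 / 5 * ‖w‖ := by
    intro w hw
    rcases eq_or_ne w 0 with rfl | hw0
    · simp
    have hw0' : 0 < ‖w‖ := norm_pos_iff.2 hw0
    have h1 := hcon (‖w‖⁻¹ • w) (U.smul_mem _ hw) (norm_smul_inv_norm hw0)
    rw [map_smul, norm_smul, norm_inv, norm_norm, inv_mul_lt_iff₀ hw0'] at h1
    linarith
  set D : V →L[ℝ] V := ContinuousLinearMap.id ℝ V + U.starProjection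
  have hD : D.det = 2 ^ Module.finrank ℝ U := det_add_starProjection U
  have hmem : ((5 / 7 : ℝ) • A.comp D) ∈ K := by
    change ‖b.comp _‖ ≤ 1
    refine ContinuousLinearMap.opNorm_le_bound _ zero_le_one fun v => ?_
    have h1 : ‖b.comp A v‖ ≤ ‖v‖ := by simpa using (b.comp A).le_of_opNorm_le hAK v
    have h2 := hsmall (U.starProjection v) (U.starProjection_apply_mem v)
    have h3 : ‖U.starProjection v‖ ≤ ‖v‖ := by
      simpa using U.starProjection.le_of_opNorm_le U.starProjection_norm_le v
    have h4 : b.comp ((5 / 7 : ℝ) • A.comp D) v =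
        (5 / 7 : ℝ) • (b.comp A v + b.comp A (U.starProjection v)) := by
      simp [D]
    rw [h4, norm_smul, one_mul, Real.norm_of_nonneg (by norm_num)]
    have h5 := norm_add_le (b.comp A v) (b.comp A (U.starProjection v))
    linarith
  have h1 := hdet _ hmem
  have hcomp : (A.comp D).det = A.det * D.det := LinearMap.det_comp _ _
  rw [hscale, hcomp, hD, abs_mul, abs_mul, abs_of_pos (by positivity : (0 : ℝ) < (5 / 7) ^ (2 * m)),
    abs_of_pos (by positivity : (0 : ℝ) < 2 ^ Module.finrank ℝ U)] at h1
  have h2 : (2 : ℝ) ^ m ≤ 2 ^ Module.finrank ℝ U := pow_le_pow_right₀ (by norm_num) hU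
  have h3 : (1 : ℝ) < (5 / 7) ^ (2 * m) * 2 ^ m := by
    rw [pow_mul, ← mul_pow]
    exact one_lt_pow₀ (by norm_num) hm.ne'
  have h4 : (5 / 7 : ℝ) ^ (2 * m) * 2 ^ m ≤ (5 / 7) ^ (2 * m) * 2 ^ Module.finrank ℝ U := by
    gcongr
  nlinarith

/-- The **Dvoretzky–Rogers lemma**. -/
theorem exists_dvoretzkyRogers (h : ¬ FiniteDimensional ℝ X) (m : ℕ) :
    ∃ u : EuclideanSpace ℝ (Fin m) →L[ℝ] X, ‖u‖ ≤ 1 ∧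
      ∀ i, 2 / 5 ≤ ‖u (EuclideanSpace.single i 1)‖ := by
  obtain ⟨u, hu, hU⟩ := exists_norm_ge_of_finrank_ge h m
  have key : ∀ k ≤ m, ∃ e : Fin k → EuclideanSpace ℝ (Fin (2 * m)), Orthonormal ℝ e ∧
      ∀ i, 2 / 5 ≤ ‖u (e i)‖ := by
    intro k
    induction k with
    | zero => exact fun _ => ⟨Fin.elim0, ⟨fun i => i.elim0, fun i => i.elim0⟩, fun i => i.elim0⟩
    | succ k ih =>
      intro hk
      obtain ⟨e, he, hue⟩ := ih (by omega)
      set S := Submodule.span ℝ (Set.range e)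
      have hS : Module.finrank ℝ S ≤ k := by
        have := finrank_range_le_card (R := ℝ) e
        rwa [Fintype.card_fin] at this
      have hS' := S.finrank_add_finrank_orthogonal
      rw [finrank_euclideanSpace_fin] at hS'
      obtain ⟨w, hwS, hw1, hw⟩ := hU Sᗮ (by omega) (by omega)
      have hperp : ∀ i, ⟪e i, w⟫ = 0 := fun i =>
        Submodule.inner_right_of_mem_orthogonal (Submodule.subset_span (Set.mem_range_self i)) hwS
      refine ⟨Fin.snoc e w, ?_, fun i => ?_⟩
      · refine ⟨fun i => ?_, fun i j hij => ?_⟩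
        · refine Fin.lastCases ?_ (fun i => ?_) i
          · simpa using hw1
          · simpa using he.1 i
        · revert hij
          refine Fin.lastCases ?_ (fun i => ?_) i <;> refine Fin.lastCases ?_ (fun j => ?_) j
          · simp
          · intro _
            simpa [real_inner_comm] using hperp j
          · intro _
            simpa using hperp i
          · intro hij
            simpa using he.2 (fun h => hij (by rw [h]))
      · refine Fin.lastCases ?_ (fun i => ?_) i
        · simpa using hw
        · simpa using hue i
  obtain ⟨e, he, hue⟩ := key m le_rfl
  obtain ⟨T, hT, hTn⟩ := exists_isometry_of_orthonormal he
  refine ⟨u.comp T, ?_, fun i => ?_⟩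
  · refine ContinuousLinearMap.opNorm_le_bound _ zero_le_one fun v => ?_
    have := u.le_of_opNorm_le hu (T v)
    rw [hTn] at this
    exact this
  · have : T (EuclideanSpace.single i 1) = e i := by
      rw [hT, Finset.sum_eq_single i] <;> simp +contextual
    change 2 / 5 ≤ ‖u (T _)‖
    rw [this]
    exact hue i

end DvoretzkyRogers

section Dvoretzky

variable {X : Type*} [NormedAddCommGroup X] [NormedSpace ℝ X]

/-- A finite-dimensional subspace is normed, up to a factor two, by finitely many functionals. -/
lemma exists_finset_norming (E : Submodule ℝ X) [FiniteDimensional ℝ E] :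
    ∃ s : Finset (StrongDual ℝ X), (∀ φ ∈ s, ‖φ‖ ≤ 1) ∧ ∀ e ∈ E, ∃ φ ∈ s, ‖e‖ ≤ 2 * φ e := by
  classical
  obtain ⟨t, hts, htf, ht⟩ := (isCompact_sphere (0 : E) 1).finite_cover_balls
    (e := 1 / 2) (by norm_num)
  choose g hg1 hg' using fun x : X => exists_dual_vector'' ℝ x
  have hg : ∀ x, g x x = ‖x‖ := hg'
  refine ⟨insert 0 (htf.toFinset.image fun x : E => g x), ?_, fun e he => ?_⟩
  · simp only [Finset.mem_insert, Finset.mem_image]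
    rintro φ (rfl | ⟨x, -, rfl⟩)
    · simp
    · exact hg1 _
  rcases eq_or_ne e 0 with rfl | he0
  · exact ⟨0, by simp, by simp⟩
  have he0' : 0 < ‖e‖ := norm_pos_iff.2 he0
  have hmem : (⟨‖e‖⁻¹ • e, E.smul_mem _ he⟩ : E) ∈ Metric.sphere (0 : E) 1 := by
    simpa using norm_smul_inv_norm (𝕜 := ℝ) he0
  obtain ⟨x, hx, hxe⟩ := Set.mem_iUnion₂.1 (ht hmem)
  refine ⟨g x, ?_, ?_⟩
  · simp only [Finset.mem_insert, Finset.mem_image]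
    exact Or.inr ⟨x, by simpa using hx, rfl⟩
  rw [Metric.mem_ball, dist_eq_norm] at hxe
  set y : X := ‖e‖⁻¹ • e with hy
  have hxe' : ‖y - x‖ < 1 / 2 := hxe
  have hyn : ‖y‖ = 1 := norm_smul_inv_norm (𝕜 := ℝ) he0
  have h1 : g x e = ‖e‖ * g x y := by
    rw [hy, map_smul, smul_eq_mul]
    field_simp
  have h2 : g x (y - x) ≥ -‖y - x‖ := by
    have := (g x).le_of_opNorm_le (hg1 x) (y - x)
    rw [one_mul, Real.norm_eq_abs] at this
    exact (abs_le.1 this).1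
  rw [map_sub, hg, norm_sub_rev] at h2
  have h3 := norm_sub_norm_le y x
  have h4 : ‖(x : X)‖ = 1 := mem_sphere_zero_iff_norm.1 (hts hx)
  rw [h1]
  rw [norm_sub_rev] at h2
  nlinarith

/-- A finite maximum of contractive functionals is measurable with a measurable subgradient. -/
lemma exists_subgradient_finset {V : Type*} [NormedAddCommGroup V] [InnerProductSpace ℝ V]
    [CompleteSpace V] [MeasurableSpace V] [BorelSpace V] {u : V →L[ℝ] X} (hu : ‖u‖ ≤ 1)
    (s : Finset (StrongDual ℝ X)) (hs : ∀ φ ∈ s, ‖φ‖ ≤ 1) :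
    ∃ (F : V → ℝ) (G : V → V), Measurable F ∧ Measurable G ∧ (∀ x, ‖G x‖ ≤ 1) ∧
      (∀ x y, F x + ⟪G x, y - x⟫ ≤ F y) ∧ (∀ x, ∀ φ ∈ s, φ (u x) ≤ F x) ∧
      ∀ x, F x ≤ ‖u x‖ := by
  classical
  induction s using Finset.induction_on with
  | empty => exact ⟨0, 0, measurable_const, measurable_const, by simp, by simp, by simp, by simp⟩
  | insert φ s _ ih =>
    obtain ⟨F, G, hF, hG, hG1, hsub, hle, hFu⟩ := ih fun ψ hψ => hs ψ (Finset.mem_insert_of_mem hψ)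
    have hφ : ‖φ‖ ≤ 1 := hs φ (Finset.mem_insert_self _ _)
    set g : V := (InnerProductSpace.toDual ℝ V).symm (φ.comp u)
    have hg : ∀ x, ⟪g, x⟫ = φ (u x) := fun x => by simp [g]
    have hg1 : ‖g‖ ≤ 1 := by
      rw [LinearIsometryEquiv.norm_map]
      exact (φ.opNorm_comp_le u).trans (mul_le_one₀ hφ (norm_nonneg _) hu)
    have hφm : Measurable fun x => φ (u x) := (φ.comp u).continuous.measurable
    have hm : MeasurableSet {x | F x ≤ φ (u x)} :=
      measurableSet_le hF hφm
    refine ⟨fun x => max (F x) (φ (u x)), fun x => if F x ≤ φ (u x) then g else G x,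
      hF.max hφm, Measurable.ite hm measurable_const hG, fun x => ?_, fun x y => ?_,
      fun x ψ hψ => ?_, fun x => ?_⟩
    · dsimp only
      split_ifs
      exacts [hg1, hG1 x]
    · dsimp only
      split_ifs with h
      · rw [max_eq_right h, hg, map_sub, map_sub]
        exact le_max_of_le_right (by linarith)
      · rw [max_eq_left (not_le.1 h).le]
        exact le_max_of_le_left (hsub x y)
    · rcases Finset.mem_insert.1 hψ with rfl | hψ
      · exact le_max_right _ _
      · exact le_max_of_le_left (hle x ψ hψ)
    · refine max_le (hFu x) ?_
      have := φ.le_of_opNorm_le hφ (u x)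
      rw [one_mul] at this
      exact (le_abs_self _).trans this

/-- The distribution under the standard Gaussian measure of an equivalent convex functional
is concentrated around its mean. -/
lemma exists_concentrated {V : Type*} [NormedAddCommGroup V] [InnerProductSpace ℝ V]
    [FiniteDimensional ℝ V] [MeasurableSpace V] [BorelSpace V] (u : V →L[ℝ] X) (hu : ‖u‖ ≤ 1) :
    ∃ F : V → ℝ, Measurable F ∧ MemLp F 2 (stdGaussian V) ∧ Var[F; stdGaussian V] ≤ 8 ∧
      (∀ x, F x ≤ ‖u x‖) ∧ (∀ x, ‖u x‖ ≤ 2 * F x) := by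
  obtain ⟨s, hs, hnorm⟩ := exists_finset_norming u.range
  obtain ⟨F, G, hF, hG, hG1, hsub, hle, hFu⟩ := exists_subgradient_finset hu s hs
  obtain ⟨h1, h2⟩ := variance_stdGaussian_le_of_subgradient hF hG hG1 hsub
  refine ⟨F, hF, h1, h2, hFu, fun x => ?_⟩
  obtain ⟨φ, hφ, hx⟩ := hnorm (u x) ⟨x, rfl⟩
  linarith [hle x φ hφ]

/-- The image of a standard Gaussian measure under a coisometry is standard Gaussian. -/
lemma stdGaussian_map_of_adjoint_isometry {V W : Type*}
    [NormedAddCommGroup V] [InnerProductSpace ℝ V] [FiniteDimensional ℝ V] [MeasurableSpace V]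
    [BorelSpace V] [NormedAddCommGroup W] [InnerProductSpace ℝ W] [FiniteDimensional ℝ W]
    [MeasurableSpace W] [BorelSpace W] (L : W →L[ℝ] V) (A : V → W)
    (hA : ∀ t, ‖A t‖ = ‖t‖) (hL : ∀ w t, ⟪L w, t⟫ = ⟪w, A t⟫) :
    (stdGaussian W).map L = stdGaussian V := by
  refine Measure.ext_of_charFun (funext fun t => ?_)
  rw [charFun_apply, integral_map (by fun_prop) (by fun_prop)]
  simp_rw [hL]
  rw [← charFun_apply, charFun_stdGaussian, charFun_stdGaussian, hA]

/-- Bounds on a net of the unit sphere give bounds on the whole space. -/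
lemma bounds_of_net {E : Type*} [NormedAddCommGroup E] [NormedSpace ℝ E] (Φ : E →L[ℝ] X)
    {t : Set E} (ht : Metric.sphere (0 : E) 1 ⊆ ⋃ x ∈ t, Metric.ball x (1 / 10)) {M : ℝ}
    (hM : 0 ≤ M) (hlow : ∀ a ∈ t, 3 / 4 * M ≤ ‖Φ a‖) (hup : ∀ a ∈ t, ‖Φ a‖ ≤ 5 / 2 * M)
    (v : E) : 4 / 9 * M * ‖v‖ ≤ ‖Φ v‖ ∧ ‖Φ v‖ ≤ 28 / 9 * M * ‖v‖ := by
  have hnet : ∀ v : E, ‖v‖ = 1 → ∃ a ∈ t, ‖Φ (v - a)‖ ≤ ‖Φ‖ / 10 := fun v hv => by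
    obtain ⟨a, ha, hva⟩ := Set.mem_iUnion₂.1 (ht (mem_sphere_zero_iff_norm.2 hv))
    rw [Metric.mem_ball, dist_eq_norm] at hva
    refine ⟨a, ha, (Φ.le_opNorm _).trans ?_⟩
    nlinarith [norm_nonneg Φ]
  have hΦ : ‖Φ‖ ≤ 5 / 2 * M + ‖Φ‖ / 10 := by
    refine ContinuousLinearMap.opNorm_le_of_unit_norm (by positivity) fun v hv => ?_
    obtain ⟨a, ha, hva⟩ := hnet v hv
    have h1 := hup a ha
    have h2 := norm_add_le (Φ a) (Φ (v - a))
    rw [← map_add, add_sub_cancel] at h2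
    linarith
  constructor
  · rcases eq_or_ne v 0 with rfl | hv0
    · simp
    obtain ⟨a, ha, hva⟩ := hnet (‖v‖⁻¹ • v) (norm_smul_inv_norm (𝕜 := ℝ) hv0)
    have hv : 0 < ‖v‖ := norm_pos_iff.2 hv0
    have h1 := hlow a ha
    have h2 := norm_sub_le (Φ (‖v‖⁻¹ • v)) (Φ (‖v‖⁻¹ • v - a))
    rw [← map_sub, sub_sub_cancel, map_smul, norm_smul, norm_inv, norm_norm] at h2
    have h3 : 4 / 9 * M ≤ ‖v‖⁻¹ * ‖Φ v‖ := by
      rw [map_sub, map_smul] at hva h2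
      linarith
    rwa [le_inv_mul_iff₀ hv, mul_comm] at h3
  · refine (Φ.le_opNorm v).trans ?_
    gcongr
    linarith

/-- The combination of the rows of a matrix with the given coefficients. -/
noncomputable def rowCombination {ι κ : Type*} [Fintype ι] [Fintype κ]
    (w : EuclideanSpace ℝ (ι × κ)) :
    EuclideanSpace ℝ ι →ₗ[ℝ] EuclideanSpace ℝ κ where
  toFun a := WithLp.toLp 2 fun j => ∑ i, a i * w (i, j)
  map_add' a b := by
    ext j
    simp [add_mul, Finset.sum_add_distrib]
  map_smul' r a := by
    ext j
    simp [mul_assoc, Finset.mul_sum]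

lemma stdGaussian_map_rowCombination {ι κ : Type*} [Fintype ι] [Fintype κ]
    {a : EuclideanSpace ℝ ι} (ha : ‖a‖ = 1) :
    (stdGaussian (EuclideanSpace ℝ (ι × κ))).map (fun w => rowCombination w a) =
      stdGaussian (EuclideanSpace ℝ κ) := by
  let L : EuclideanSpace ℝ (ι × κ) →ₗ[ℝ] EuclideanSpace ℝ κ :=
    { toFun := fun w => rowCombination w a
      map_add' := fun w w' => by
        ext j
        simp [rowCombination, mul_add, Finset.sum_add_distrib]
      map_smul' := fun r w => by
        ext j
        simp [rowCombination, mul_left_comm, Finset.mul_sum] }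
  refine stdGaussian_map_of_adjoint_isometry L.toContinuousLinearMap
    (fun t => WithLp.toLp 2 fun p => a p.1 * t p.2) (fun t => ?_) (fun w t => ?_)
  · rw [← sq_eq_sq₀ (norm_nonneg _) (norm_nonneg _), EuclideanSpace.real_norm_sq_eq]
    simp only [mul_pow, Fintype.sum_prod_type]
    simp_rw [← Finset.mul_sum]
    rw [← Finset.sum_mul, ← EuclideanSpace.real_norm_sq_eq, ← EuclideanSpace.real_norm_sq_eq, ha]
    ring
  · simp only [PiLp.inner_apply, Fintype.sum_prod_type]
    rw [Finset.sum_comm]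
    simp [L, rowCombination, Finset.mul_sum, mul_assoc, mul_comm, mul_left_comm]

/-- **Dvoretzky's theorem**, in an isomorphic form with an absolute constant. -/
theorem exists_dvoretzky (h : ¬ FiniteDimensional ℝ X) (n : ℕ) :
    ∃ Φ : EuclideanSpace ℝ (Fin n) →L[ℝ] X, ∀ v, ‖v‖ ≤ ‖Φ v‖ ∧ ‖Φ v‖ ≤ 7 * ‖v‖ := by
  classical
  obtain ⟨t, hts, htf, ht⟩ := (isCompact_sphere (0 : EuclideanSpace ℝ (Fin n)) 1).finite_cover_balls
    (e := 1 / 10) (by norm_num)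
  set N : ℝ := (htf.toFinset.card : ℝ)
  have hN : 0 ≤ N := Nat.cast_nonneg _
  obtain ⟨m, hm⟩ := exists_le_integral_norm_sum_gaussian X (c := 2 / 5)
    (t := 20 * (128 * (N + 1))) (by norm_num) (by positivity)
  obtain ⟨u, hu, hue⟩ := exists_dvoretzkyRogers h m
  have hum : 2 * (128 * (N + 1)) ≤ ∫ v, ‖u v‖ ∂(stdGaussian (EuclideanSpace ℝ (Fin m))) := by
    have h1 := hm _ hue
    have h2 : ∀ v : EuclideanSpace ℝ (Fin m),
        ∑ i, v i • u (EuclideanSpace.single i 1) = u v := fun v => by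
      conv_rhs => rw [← (EuclideanSpace.basisFun (Fin m) ℝ).sum_repr v]
      simp
    simp_rw [h2] at h1
    linarith
  obtain ⟨F, hF, hF2, hvar, hFu, huF⟩ := exists_concentrated u hu
  set M := ∫ v, F v ∂(stdGaussian (EuclideanSpace ℝ (Fin m)))
  have hFint : Integrable F (stdGaussian (EuclideanSpace ℝ (Fin m))) :=
    hF2.integrable (by norm_num)
  have hM : 128 * (N + 1) ≤ M := by
    have h1 : ∫ v, ‖u v‖ ∂(stdGaussian (EuclideanSpace ℝ (Fin m))) ≤
        ∫ v, 2 * F v ∂(stdGaussian (EuclideanSpace ℝ (Fin m))) :=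
      integral_mono_of_nonneg (ae_of_all _ fun v => norm_nonneg _) (hFint.const_mul 2)
        (ae_of_all _ huF)
    rw [integral_const_mul] at h1
    linarith
  have hM0 : 0 < M := by linarith
  set μ := stdGaussian (EuclideanSpace ℝ (Fin n × Fin m))
  have hbad : ∀ a ∈ t, μ {w | M / 4 ≤ |F (rowCombination w a) - M|} ≤
      ENNReal.ofReal (128 / M ^ 2) := fun a ha => by
    have hL : Measurable fun w : EuclideanSpace ℝ (Fin n × Fin m) => rowCombination w a := by
      change Measurable fun w : EuclideanSpace ℝ (Fin n × Fin m) =>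
        WithLp.toLp 2 fun j => ∑ i, a i * w (i, j)
      fun_prop
    have hset : MeasurableSet {v | M / 4 ≤ |F v - M|} :=
      measurableSet_le measurable_const (hF.sub_const M).abs
    have h1 : μ {w | M / 4 ≤ |F (rowCombination w a) - M|} =
        stdGaussian (EuclideanSpace ℝ (Fin m)) {v | M / 4 ≤ |F v - M|} := by
      rw [← stdGaussian_map_rowCombination (mem_sphere_zero_iff_norm.1 (hts ha)),
        Measure.map_apply hL hset]
      rfl
    rw [h1]
    refine (meas_ge_le_variance_div_sq hF2 (by positivity)).trans (ENNReal.ofReal_le_ofReal ?_)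
    rw [div_pow, div_div_eq_mul_div]
    gcongr
    linarith
  have hex : ∃ w, ∀ a ∈ t, |F (rowCombination w a) - M| < M / 4 := by
    by_contra! hcon
    have h1 : (Set.univ : Set (EuclideanSpace ℝ (Fin n × Fin m))) ⊆
        ⋃ a ∈ htf.toFinset, {w | M / 4 ≤ |F (rowCombination w a) - M|} := fun w _ => by
      obtain ⟨a, ha, hw⟩ := hcon w
      exact Set.mem_iUnion₂.2 ⟨a, by simpa using ha, hw⟩
    have h2 := (measure_mono (μ := μ) h1).trans (measure_biUnion_finset_le _ _)
    have h3 := h2.trans (Finset.sum_le_sum fun a ha => hbad a (by simpa using ha))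
    rw [measure_univ, Finset.sum_const, nsmul_eq_mul, ← ENNReal.ofReal_natCast,
      ← ENNReal.ofReal_mul hN, ENNReal.one_le_ofReal] at h3
    change 1 ≤ N * (128 / M ^ 2) at h3
    rw [← mul_div_assoc, one_le_div (by positivity)] at h3
    nlinarith
  obtain ⟨w, hw⟩ := hex
  set Φ : EuclideanSpace ℝ (Fin n) →L[ℝ] X := u.comp (rowCombination w).toContinuousLinearMap
  have hlow : ∀ a ∈ t, 3 / 4 * M ≤ ‖Φ a‖ := fun a ha => by
    have h1 := hFu (rowCombination w a)
    have h2 := (abs_lt.1 (hw a ha)).1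
    change _ ≤ ‖u (rowCombination w a)‖
    linarith
  have hup : ∀ a ∈ t, ‖Φ a‖ ≤ 5 / 2 * M := fun a ha => by
    have h1 := huF (rowCombination w a)
    have h2 := (abs_lt.1 (hw a ha)).2
    change ‖u (rowCombination w a)‖ ≤ _
    linarith
  refine ⟨(9 / (4 * M)) • Φ, fun v => ?_⟩
  obtain ⟨h1, h2⟩ := bounds_of_net Φ ht hM0.le hlow hup v
  rw [smul_apply, norm_smul, Real.norm_of_nonneg (by positivity)]
  have h3 : 9 / (4 * M) * (4 / 9 * M * ‖v‖) = ‖v‖ := by field_simp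
  have h4 : 9 / (4 * M) * (28 / 9 * M * ‖v‖) = 7 * ‖v‖ := by field_simp; ring
  exact ⟨h3.symm.trans_le (by gcongr), le_trans (by gcongr) h4.le⟩

end Dvoretzky

section UniformComplementation

variable {X : Type*} [NormedAddCommGroup X] [NormedSpace ℝ X]

/-- The subspace `E` is the range of a bounded projection of norm at most `c`. -/
def IsComplementedWith (E : Submodule ℝ X) (c : ℝ) : Prop :=
  ∃ P : X →L[ℝ] X, ‖P‖ ≤ c ∧ (∀ x, P x ∈ E) ∧ ∀ x ∈ E, P x = x

lemma IsComplementedWith.of_inf_ker {E : Submodule ℝ X} {c : ℝ} (f : StrongDual ℝ X)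
    (h : IsComplementedWith (E ⊓ f.ker) c) : IsComplementedWith E (2 * c + 1) := by
  obtain ⟨P, hPc, hPE, hP⟩ := h
  have hc : 0 ≤ c := (norm_nonneg P).trans hPc
  by_cases hE : E ≤ f.ker
  · rw [inf_eq_left.2 hE] at hPE hP
    exact ⟨P, by linarith, hPE, hP⟩
  obtain ⟨e, he, hfe⟩ := SetLike.not_le_iff_exists.1 hE
  have hPf : ∀ x, f (P x) = 0 := fun x => (hPE x).2
  set w := e - P e with hw
  have hwE : w ∈ E := E.sub_mem he (hPE e).1
  have hfw : f w ≠ 0 := by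
    rw [hw, map_sub, hPf, sub_zero]
    exact hfe
  have hw0 : ‖w‖ ≠ 0 := fun h => hfw (by rw [norm_eq_zero.1 h, map_zero])
  have hPw : P w = 0 := by rw [hw, map_sub, hP _ (hPE e), sub_self]
  obtain ⟨g, hg1, hgw⟩ := exists_dual_vector ℝ w hw0
  replace hgw : g w = ‖w‖ := hgw
  let Q : X →L[ℝ] X :=
    P + (g.comp (ContinuousLinearMap.id ℝ X - P)).smulRight (‖w‖⁻¹ • w)
  have hQ : ∀ x, Q x = P x + g (x - P x) • ‖w‖⁻¹ • w := fun x => by simp [Q]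
  refine ⟨Q, ContinuousLinearMap.opNorm_le_bound _ (by positivity) fun x => ?_, fun x => ?_,
    fun x hx => ?_⟩
  · have h1 : ‖P x‖ ≤ c * ‖x‖ := P.le_of_opNorm_le hPc x
    have h2 : ‖g (x - P x)‖ ≤ ‖x - P x‖ := by simpa using g.le_of_opNorm_le hg1.le (x - P x)
    have h3 : ‖(‖w‖⁻¹ • w)‖ = 1 := by rw [norm_smul, norm_inv, norm_norm, inv_mul_cancel₀ hw0]
    have h4 := norm_add_le (P x) (g (x - P x) • ‖w‖⁻¹ • w)
    rw [norm_smul (g (x - P x)), h3, mul_one] at h4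
    rw [hQ]
    linarith [norm_sub_le x (P x)]
  · rw [hQ]
    exact E.add_mem (hPE x).1 (E.smul_mem _ (E.smul_mem _ hwE))
  · have h1 : x - (f x / f w) • w ∈ E ⊓ f.ker := by
      refine ⟨E.sub_mem hx (E.smul_mem _ hwE), ?_⟩
      change f _ = 0
      rw [map_sub, map_smul, smul_eq_mul, div_mul_cancel₀ _ hfw, sub_self]
    have h2 := hP _ h1
    rw [map_sub, map_smul, hPw, smul_zero, sub_zero] at h2
    rw [hQ, h2, sub_sub_cancel, map_smul, hgw, smul_smul, smul_eq_mul, mul_assoc,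
      mul_inv_cancel₀ hw0, mul_one, sub_add_cancel]

/-- There is no uniform bound for projections onto finite-dimensional subspaces of `K`. -/
def HasBadSubspaces (K : Submodule ℝ X) : Prop :=
  ∀ c : ℝ, ∃ E ≤ K, FiniteDimensional ℝ E ∧ ¬ IsComplementedWith E c

lemma HasBadSubspaces.inf_ker {K : Submodule ℝ X} (hK : HasBadSubspaces K) (f : StrongDual ℝ X) :
    HasBadSubspaces (K ⊓ f.ker) := by
  intro c
  obtain ⟨E, hEK, hE, hcE⟩ := hK (2 * c + 1)
  exact ⟨E ⊓ f.ker, inf_le_inf_right _ hEK, inferInstance, fun h => hcE h.of_inf_ker⟩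

lemma HasBadSubspaces.exists_le {K : Submodule ℝ X} (hK : HasBadSubspaces K)
    (s : Finset (StrongDual ℝ X)) :
    ∃ K' ≤ K, HasBadSubspaces K' ∧ ∀ φ ∈ s, ∀ x ∈ K', φ x = 0 := by
  classical
  induction s using Finset.induction_on with
  | empty => exact ⟨K, le_rfl, hK, by simp⟩
  | insert φ s _ ih =>
    obtain ⟨K', hK', hbad, h⟩ := ih
    refine ⟨K' ⊓ φ.ker, inf_le_left.trans hK', hbad.inf_ker φ, fun ψ hψ x hx => ?_⟩
    rcases Finset.mem_insert.1 hψ with rfl | hψ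
    exacts [hx.2, h ψ hψ x hx.1]

/-- A bounded projection `R` onto `S`, together with a complementary subspace `K` to which `S` is
almost orthogonal. -/
structure IsSplitting (S K : Submodule ℝ X) (R : X →L[ℝ] X) : Prop where
  mem : ∀ x, R x ∈ S
  eq_self : ∀ x ∈ S, R x = x
  eq_zero : ∀ x ∈ K, R x = 0
  norm_le : ∀ s ∈ S, ∀ x ∈ K, ‖s‖ ≤ 2 * ‖s + x‖

lemma HasBadSubspaces.exists_isSplitting {K : Submodule ℝ X} (hK : HasBadSubspaces K)
    (S : Submodule ℝ X) [FiniteDimensional ℝ S] :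
    ∃ K' ≤ K, HasBadSubspaces K' ∧ ∃ R, IsSplitting S K' R := by
  classical
  obtain ⟨p, hp⟩ := Submodule.ClosedComplemented.of_finiteDimensional S
  set R : X →L[ℝ] X := S.subtypeL.comp p
  have hRS : ∀ x, R x ∈ S := fun x => (p x).2
  obtain ⟨s, hs, hnorm⟩ := exists_finset_norming S
  obtain ⟨K', hK'K, hK', hker⟩ := hK.exists_le (s ∪ s.image fun φ => φ.comp R)
  refine ⟨K', hK'K, hK', R, hRS, fun x hx => congrArg Subtype.val (hp ⟨x, hx⟩), fun x hx => ?_,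
    fun y hy x hx => ?_⟩
  · obtain ⟨φ, hφ, hle⟩ := hnorm (R x) (hRS x)
    have : φ.comp R x = 0 := hker _ (Finset.mem_union_right _ (Finset.mem_image_of_mem _ hφ)) x hx
    rw [ContinuousLinearMap.comp_apply] at this
    rw [this, mul_zero] at hle
    exact norm_le_zero_iff.1 hle
  · obtain ⟨φ, hφ, hle⟩ := hnorm y hy
    have h1 : φ x = 0 := hker _ (Finset.mem_union_left _ hφ) x hx
    have h2 := φ.le_of_opNorm_le (hs φ hφ) (y + x)
    rw [map_add, h1, add_zero, one_mul] at h2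
    linarith [le_abs_self (φ y), Real.norm_eq_abs (φ y)]

/-- If every closed subspace is complemented, then the finite-dimensional subspaces are uniformly
complemented. -/
theorem exists_uniform_isComplementedWith
    (h : ∀ Y : Submodule ℝ X, IsClosed (Y : Set X) →
      ∃ P : X →L[ℝ] X, (∀ x, P x ∈ Y) ∧ ∀ x ∈ Y, P x = x) :
    ∃ c : ℝ, ∀ E : Submodule ℝ X, FiniteDimensional ℝ E → IsComplementedWith E c := by
  by_contra! hcon
  have hbad : HasBadSubspaces (⊤ : Submodule ℝ X) := fun c => by
    obtain ⟨E, hE, hcE⟩ := hcon c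
    exact ⟨E, le_top, hE, hcE⟩
  let State := {p : Submodule ℝ X × Submodule ℝ X × (X →L[ℝ] X) //
    FiniteDimensional ℝ p.1 ∧ HasBadSubspaces p.2.1 ∧ IsSplitting p.1 p.2.1 p.2.2}
  have hstep : ∀ (n : ℕ) (p : State), ∃ (q : State) (E : Submodule ℝ X), E ≤ p.1.2.1 ∧
      FiniteDimensional ℝ E ∧ ¬ IsComplementedWith E n ∧ q.1.1 = p.1.1 ⊔ E ∧
      q.1.2.1 ≤ p.1.2.1 := by
    rintro n ⟨⟨S, K, R⟩, hS, hK, hR⟩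
    obtain ⟨E, hEK, hE, hcE⟩ := hK n
    dsimp only at hS
    obtain ⟨K', hK'K, hK', R', hR'⟩ := hK.exists_isSplitting (S ⊔ E)
    exact ⟨⟨⟨S ⊔ E, K', R'⟩, inferInstance, hK', hR'⟩, E, hEK, hE, hcE, rfl, hK'K⟩
  choose next E hEK hE hcE hnext hKnext using hstep
  let start : State := ⟨⟨⊥, ⊤, 0⟩, inferInstance, hbad,
    by simp, fun x hx => by simpa using ((Submodule.mem_bot ℝ).1 hx).symm, by simp,
    fun s hs x _ => by rw [(Submodule.mem_bot ℝ).1 hs, norm_zero]; positivity⟩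
  let seq : ℕ → State := fun n => Nat.rec start next n
  let S : ℕ → Submodule ℝ X := fun n => (seq n).1.1
  let K : ℕ → Submodule ℝ X := fun n => (seq n).1.2.1
  let R : ℕ → X →L[ℝ] X := fun n => (seq n).1.2.2
  let D : ℕ → Submodule ℝ X := fun n => E n (seq n)
  have hS : ∀ n, S (n + 1) = S n ⊔ D n := fun n => hnext n (seq n)
  have hKK : Antitone K := antitone_nat_of_succ_le fun n => hKnext n (seq n)
  have hDK : ∀ n, D n ≤ K n := fun n => hEK n (seq n)
  have hSS : Monotone S := monotone_nat_of_le_succ fun n => (hS n).symm ▸ le_sup_left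
  have hR : ∀ n, IsSplitting (S n) (K n) (R n) := fun n => (seq n).2.2.2
  have hsub : ∀ n N, n ≤ N → ∀ x ∈ S N, x - R n x ∈ K n := fun n N hnN => by
    induction N, hnN using Nat.le_induction with
    | base =>
      intro x hx
      rw [(hR n).eq_self x hx, sub_self]
      exact zero_mem _
    | succ N hnN ih =>
      intro x hx
      rw [hS] at hx
      obtain ⟨a, ha, b, hb, rfl⟩ := Submodule.mem_sup.1 hx
      have hbK : b ∈ K n := hKK hnN (hDK N hb)
      rw [map_add, (hR n).eq_zero b hbK, add_zero, add_sub_right_comm]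
      exact add_mem (ih a ha) hbK
  have hsub' : ∀ n, ∀ x ∈ ⨆ N, S N, x - R n x ∈ K n := fun n x hx => by
    obtain ⟨N, hN⟩ := (Submodule.mem_iSup_of_directed S hSS.directed_le).1 hx
    exact hsub n (max n N) (le_max_left _ _) x (hSS (le_max_right _ _) hN)
  have hbound : ∀ n, ∀ x ∈ ⨆ N, S N, ‖R n x‖ ≤ 2 * ‖x‖ := fun n x hx => by
    simpa using (hR n).norm_le _ ((hR n).mem x) _ (hsub' n x hx)
  have hmem : ∀ n, ∀ x ∈ ⨆ N, S N, (R (n + 1) - R n) x ∈ D n := fun n x hx => by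
    have h1 := (hR (n + 1)).mem x
    rw [hS] at h1
    obtain ⟨a, ha, b, hb, hab⟩ := Submodule.mem_sup.1 h1
    have h2 := (hR n).eq_zero _ (hKK (Nat.le_succ n) (hsub' (n + 1) x hx))
    rw [← hab, map_sub, map_add, (hR n).eq_self a ha, (hR n).eq_zero b (hDK n hb), add_zero,
      sub_eq_zero] at h2
    rw [sub_apply, ← hab, h2, add_sub_cancel_left]
    exact hb
  obtain ⟨P, hPY, hP⟩ := h (⨆ N, S N).topologicalClosure
    (Submodule.isClosed_topologicalClosure _)
  obtain ⟨n, hn⟩ := exists_nat_ge (4 * ‖P‖)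
  have hDfin : FiniteDimensional ℝ (D n) := hE n (seq n)
  have hclosed : IsClosed {x | (R (n + 1) - R n) x ∈ D n ∧ ‖(R (n + 1) - R n) x‖ ≤ 4 * ‖x‖} :=
    ((D n).closed_of_finiteDimensional.preimage (R (n + 1) - R n).continuous).inter
      (isClosed_le (R (n + 1) - R n).continuous.norm (by fun_prop))
  have hsubset : ((⨆ N, S N : Submodule ℝ X) : Set X) ⊆
      {x | (R (n + 1) - R n) x ∈ D n ∧ ‖(R (n + 1) - R n) x‖ ≤ 4 * ‖x‖} := fun y hy => by
    refine ⟨hmem n y hy, ?_⟩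
    rw [sub_apply]
    linarith [norm_sub_le (R (n + 1) y) (R n y), hbound n y hy, hbound (n + 1) y hy]
  have hY : ∀ x ∈ (⨆ N, S N).topologicalClosure,
      (R (n + 1) - R n) x ∈ D n ∧ ‖(R (n + 1) - R n) x‖ ≤ 4 * ‖x‖ := fun x hx =>
    closure_minimal hsubset hclosed hx
  refine hcE n (seq n) ⟨(R (n + 1) - R n).comp P, ?_, fun x => (hY _ (hPY x)).1, fun x hx => ?_⟩
  · refine (ContinuousLinearMap.opNorm_le_bound _ (by positivity) fun x => ?_).trans hn
    refine (hY _ (hPY x)).2.trans ?_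
    linarith [P.le_opNorm x]
  · have hxS : x ∈ S (n + 1) := (hS n).symm ▸ Submodule.mem_sup_right hx
    have hxY : x ∈ (⨆ N, S N).topologicalClosure :=
      Submodule.le_topologicalClosure _ (Submodule.mem_iSup_of_mem (p := S) (n + 1) hxS)
    rw [ContinuousLinearMap.comp_apply, hP x hxY, sub_apply,
      (hR (n + 1)).eq_self x hxS, (hR n).eq_zero x (hDK n hx), sub_zero]

end UniformComplementation

section UniformlyHilbertian

variable {X : Type*} [NormedAddCommGroup X] [NormedSpace ℝ X]

/-- Dvoretzky's theorem inside a subspace of finite codimension. -/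
theorem exists_dvoretzky_of_finset (h : ¬ FiniteDimensional ℝ X) (s : Finset (StrongDual ℝ X))
    (n : ℕ) : ∃ Φ : EuclideanSpace ℝ (Fin n) →L[ℝ] X,
      (∀ v, ‖v‖ ≤ ‖Φ v‖ ∧ ‖Φ v‖ ≤ 7 * ‖v‖) ∧ ∀ φ ∈ s, ∀ v, φ (Φ v) = 0 := by
  obtain ⟨Φ, hΦ⟩ := exists_dvoretzky h (n + s.card)
  let A : EuclideanSpace ℝ (Fin (n + s.card)) →ₗ[ℝ] (s → ℝ) :=
    LinearMap.pi fun φ => (φ.1.comp Φ).toLinearMap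
  have hA : n ≤ Module.finrank ℝ A.ker := by
    have h1 := A.finrank_range_add_finrank_ker
    have h2 := A.range.finrank_le
    rw [finrank_euclideanSpace_fin] at h1
    rw [Module.finrank_fintype_fun_eq_card, Fintype.card_coe] at h2
    omega
  have ho : Orthonormal ℝ fun i : Fin n => stdOrthonormalBasis ℝ A.ker (Fin.castLE hA i) :=
    (stdOrthonormalBasis ℝ A.ker).orthonormal.comp _ (Fin.castLE_injective hA)
  obtain ⟨T, -, hT⟩ := exists_isometry_of_orthonormal ho
  refine ⟨Φ.comp (A.ker.subtypeL.comp T), fun v => ?_, fun φ hφ v => ?_⟩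
  · have h1 := hΦ (T v : EuclideanSpace ℝ (Fin (n + s.card)))
    have h2 : ‖(T v : EuclideanSpace ℝ (Fin (n + s.card)))‖ = ‖v‖ := hT v
    rw [h2] at h1
    exact h1
  · exact congrFun (T v).2 ⟨φ, hφ⟩

/-- The Banach–Mazur distance of the finite-dimensional subspace `E` to a Hilbert space is at
most `d`. -/
def IsHilbertianWith (E : Submodule ℝ X) (d : ℝ) : Prop :=
  ∃ (n : ℕ) (j : E →ₗ[ℝ] EuclideanSpace ℝ (Fin n)), ∀ e, ‖e‖ ≤ ‖j e‖ ∧ ‖j e‖ ≤ d * ‖e‖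

lemma IsHilbertianWith.mono {E : Submodule ℝ X} {d d' : ℝ} (h : IsHilbertianWith E d)
    (hd : d ≤ d') : IsHilbertianWith E d' := by
  obtain ⟨n, j, hj⟩ := h
  exact ⟨n, j, fun e => ⟨(hj e).1, (hj e).2.trans (by gcongr)⟩⟩

lemma IsHilbertianWith.of_linearMap {E : Submodule ℝ X} {d : ℝ} {H : Type*} [NormedAddCommGroup H]
    [InnerProductSpace ℝ H] [FiniteDimensional ℝ H] (j : E →ₗ[ℝ] H)
    (hj : ∀ e, ‖e‖ ≤ ‖j e‖ ∧ ‖j e‖ ≤ d * ‖e‖) : IsHilbertianWith E d :=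
  ⟨_, (stdOrthonormalBasis ℝ H).repr.toLinearEquiv.toLinearMap ∘ₗ j, fun e => by
    have : ‖((stdOrthonormalBasis ℝ H).repr.toLinearEquiv.toLinearMap ∘ₗ j) e‖ = ‖j e‖ :=
      (stdOrthonormalBasis ℝ H).repr.norm_map (j e)
    rw [this]
    exact hj e⟩

lemma exists_isHilbertianWith (E : Submodule ℝ X) [FiniteDimensional ℝ E] :
    ∃ d, 1 ≤ d ∧ IsHilbertianWith E d := by
  let T : E ≃L[ℝ] EuclideanSpace ℝ (Fin (Module.finrank ℝ E)) :=
    ContinuousLinearEquiv.ofFinrankEq (by simp)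
  obtain ⟨a, ha0, ha'⟩ := T.symm.toContinuousLinearMap.bound
  obtain ⟨b, -, hb⟩ := T.toContinuousLinearMap.bound
  have ha : ∀ e, ‖e‖ ≤ a * ‖T e‖ := fun e => by simpa using ha' (T e)
  refine ⟨max 1 (a * b), le_max_left _ _, IsHilbertianWith.mono
    ⟨Module.finrank ℝ E, a • T.toLinearMap, fun e => ?_⟩ (le_max_right _ _)⟩
  have h1 : ‖(a • T.toLinearMap) e‖ = a * ‖T e‖ := by
    rw [LinearMap.smul_apply, norm_smul, Real.norm_of_nonneg ha0.le]
    rfl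
  rw [h1, mul_assoc]
  exact ⟨ha e, mul_le_mul_of_nonneg_left (hb e) ha0.le⟩

/-- Uniform complementation improves the distance of a subspace to a Hilbert space: its graph over
an almost Euclidean subspace is complemented. -/
lemma IsHilbertianWith.improve (h : ¬ FiniteDimensional ℝ X) {c d : ℝ}
    (hc : ∀ E : Submodule ℝ X, FiniteDimensional ℝ E → IsComplementedWith E c) (hd : 1 ≤ d)
    {E : Submodule ℝ X} [FiniteDimensional ℝ E] (hE : IsHilbertianWith E d) :
    IsHilbertianWith E (21 * c * √d) := by
  obtain ⟨n, j, hj⟩ := hE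
  obtain ⟨s, hs, hnorm⟩ := exists_finset_norming E
  obtain ⟨Φ, hΦ, hΦs⟩ := exists_dvoretzky_of_finset h s n
  have hEΦ : ∀ e : E, ∀ v, ‖e‖ ≤ 2 * ‖(e : X) + Φ v‖ := fun e v => by
    obtain ⟨φ, hφ, hle⟩ := hnorm e e.2
    have h1 := φ.le_of_opNorm_le (hs φ hφ) (e + Φ v)
    rw [map_add, hΦs φ hφ, add_zero, one_mul] at h1
    have h2 := le_abs_self (φ e)
    rw [Real.norm_eq_abs] at h1
    rw [Submodule.coe_norm]
    linarith
  have hr : 0 < √d := Real.sqrt_pos.2 (by linarith)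
  have hrd : √d * √d = d := Real.mul_self_sqrt (by linarith)
  set i : E →ₗ[ℝ] EuclideanSpace ℝ (Fin n) := (√d)⁻¹ • j
  have hi : ∀ e, ‖i e‖ = (√d)⁻¹ * ‖j e‖ := fun e => by
    rw [LinearMap.smul_apply, norm_smul, norm_inv, Real.norm_of_nonneg hr.le]
  have hi1 : ∀ e, ‖e‖ ≤ √d * ‖i e‖ := fun e => by
    rw [hi, ← mul_assoc, mul_inv_cancel₀ hr.ne', one_mul]
    exact (hj e).1
  have hi2 : ∀ e, ‖i e‖ ≤ √d * ‖e‖ := fun e => by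
    rw [hi, inv_mul_le_iff₀ hr, ← mul_assoc, hrd]
    exact (hj e).2
  let T : E →ₗ[ℝ] X := E.subtype + Φ.toLinearMap ∘ₗ i
  have hT : ∀ e, T e = e + Φ (i e) := fun e => rfl
  have hTe : ∀ e, ‖e‖ ≤ 2 * ‖T e‖ := fun e => hEΦ e (i e)
  have hTi : ∀ e, ‖i e‖ ≤ 3 * ‖T e‖ := fun e => by
    have h1 := (hΦ (i e)).1
    have h2 := norm_sub_le (T e) e
    rw [hT, add_sub_cancel_left, ← hT, ← Submodule.coe_norm] at h2
    linarith [hTe e]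
  have hTinj : Function.Injective T := (injective_iff_map_eq_zero T).2 fun e he => by
    have := hTe e
    rw [he, norm_zero, mul_zero] at this
    exact norm_le_zero_iff.1 this
  obtain ⟨P, hPc, hPT, hP⟩ := hc T.range inferInstance
  have hc0 : 0 ≤ c := (norm_nonneg P).trans hPc
  let Θ : X →ₗ[ℝ] E := (LinearEquiv.ofInjective T hTinj).symm.toLinearMap ∘ₗ
    P.toLinearMap.codRestrict T.range hPT
  have hΘ : ∀ x, T (Θ x) = P x := fun x =>
    congrArg Subtype.val ((LinearEquiv.ofInjective T hTinj).apply_symm_apply ⟨P x, hPT x⟩)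
  have hΘT : ∀ e, Θ (T e) = e := fun e => hTinj ((hΘ _).trans (hP _ ⟨e, rfl⟩))
  have hPx : ∀ x, ‖P x‖ ≤ c * ‖x‖ := fun x => P.le_of_opNorm_le hPc x
  let q : E →ₗ[ℝ] WithLp 2 (EuclideanSpace ℝ (Fin n) × EuclideanSpace ℝ (Fin n)) :=
    √2 • ((WithLp.linearEquiv 2 ℝ _).symm.toLinearMap ∘ₗ
      ((√d • i ∘ₗ Θ ∘ₗ E.subtype).prod ((14 * c) • i)))
  have hq : ∀ e, ‖q e‖ ^ 2 = 2 * ((√d * ‖i (Θ e)‖) ^ 2 + (14 * c * ‖i e‖) ^ 2) := fun e => by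
    have h1 : q e = √2 • WithLp.toLp 2 (√d • i (Θ e), (14 * c) • i e) := rfl
    rw [h1, norm_smul, mul_pow, WithLp.prod_norm_sq_eq_of_L2, Real.norm_of_nonneg (by positivity),
      Real.sq_sqrt (by norm_num)]
    change 2 * (‖√d • i (Θ e)‖ ^ 2 + ‖(14 * c) • i e‖ ^ 2) = _
    rw [norm_smul, norm_smul, Real.norm_of_nonneg hr.le,
      Real.norm_of_nonneg (by positivity : 0 ≤ 14 * c)]
  refine .of_linearMap q fun e => ⟨?_, ?_⟩
  · have h1 : ‖Θ e‖ ≤ √d * ‖i (Θ e)‖ := hi1 _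
    have h2 : ‖Θ (Φ (i e))‖ ≤ 14 * c * ‖i e‖ := by
      have h3 := hTe (Θ (Φ (i e)))
      rw [hΘ] at h3
      have h4 := mul_le_mul_of_nonneg_left (hΦ (i e)).2 hc0
      linarith [hPx (Φ (i e))]
    have h3 : ‖e‖ ≤ ‖Θ e‖ + ‖Θ (Φ (i e))‖ := by
      conv_lhs => rw [← hΘT e, hT, map_add]
      exact norm_add_le _ _
    refine (sq_le_sq₀ (norm_nonneg _) (norm_nonneg _)).1 ?_
    rw [hq]
    have h4 : ‖e‖ ^ 2 ≤ (√d * ‖i (Θ e)‖ + 14 * c * ‖i e‖) ^ 2 := by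
      gcongr
      linarith
    nlinarith [sq_nonneg (√d * ‖i (Θ e)‖ - 14 * c * ‖i e‖)]
  · refine (sq_le_sq₀ (norm_nonneg _) (by positivity)).1 ?_
    rw [hq]
    have h1 : √d * ‖i (Θ e)‖ ≤ √d * (3 * (c * ‖e‖)) := by
      gcongr
      refine (hTi _).trans ?_
      rw [hΘ]
      gcongr
      exact hPx e
    have h2 : 14 * c * ‖i e‖ ≤ 14 * c * (√d * ‖e‖) := by
      gcongr
      exact hi2 e
    have h3 := pow_le_pow_left₀ (by positivity) h1 2
    have h4 := pow_le_pow_left₀ (by positivity) h2 2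
    have h5 : 0 ≤ (c * √d * ‖e‖) ^ 2 := sq_nonneg _
    nlinarith

/-- If the finite-dimensional subspaces are uniformly complemented, then they are uniformly
Hilbertian. -/
theorem exists_uniform_isHilbertianWith (h : ¬ FiniteDimensional ℝ X) {c : ℝ}
    (hc : ∀ E : Submodule ℝ X, FiniteDimensional ℝ E → IsComplementedWith E c) :
    ∃ D, 0 ≤ D ∧ ∀ E : Submodule ℝ X, FiniteDimensional ℝ E → IsHilbertianWith E D := by
  set K := 21 * max c 1
  have hK : 1 ≤ K := by linarith [le_max_right c 1]
  refine ⟨K ^ 2 + 1, by positivity, fun E hE => ?_⟩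
  set S := {d : ℝ | 1 ≤ d ∧ IsHilbertianWith E d}
  have hS : S.Nonempty := exists_isHilbertianWith E
  have hSb : BddBelow S := ⟨1, fun d hd => hd.1⟩
  have hc' : ∀ E : Submodule ℝ X, FiniteDimensional ℝ E → IsComplementedWith E (max c 1) :=
    fun E hE => (hc E hE).imp fun P hP => ⟨hP.1.trans (le_max_left _ _), hP.2⟩
  have hstep : ∀ d ∈ S, K * √d ∈ S := fun d hd =>
    ⟨one_le_mul_of_one_le_of_one_le hK (Real.one_le_sqrt.2 hd.1), hd.2.improve h hc' hd.1⟩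
  have h1 : 1 ≤ sInf S := le_csInf hS fun d hd => hd.1
  have h2 : sInf S ^ 2 / K ^ 2 ≤ sInf S := le_csInf hS fun d hd => by
    have h3 := pow_le_pow_left₀ (by linarith) (csInf_le hSb (hstep d hd)) 2
    rw [mul_pow, Real.sq_sqrt (by linarith [hd.1])] at h3
    rwa [div_le_iff₀' (by positivity)]
  rw [div_le_iff₀ (by positivity)] at h2
  have h3 : sInf S ≤ K ^ 2 := by nlinarith
  obtain ⟨d, hd, hlt⟩ := exists_lt_of_csInf_lt hS (h3.trans_lt (lt_add_one _))
  exact hd.2.mono hlt.le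

end UniformlyHilbertian

section Gluing

/-- A complete space with an equivalent inner product is isomorphic to a Hilbert space. -/
lemma exists_hilbert_of_core {X : Type*} [NormedAddCommGroup X] [NormedSpace ℝ X] [CompleteSpace X]
    {H : Type} [AddCommGroup H] [Module ℝ H] (cd : InnerProductSpace.Core ℝ H) (e : X ≃ₗ[ℝ] H)
    {D : ℝ} (hD : 0 ≤ D)
    (he : ∀ x, ‖x‖ ^ 2 ≤ cd.inner (e x) (e x) ∧ cd.inner (e x) (e x) ≤ (D * ‖x‖) ^ 2) :
    ∃ (H : Type) (_ : NormedAddCommGroup H) (_ : InnerProductSpace ℝ H) (_ : CompleteSpace H),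
      Nonempty (X ≃L[ℝ] H) := by
  let : NormedAddCommGroup H := cd.toNormedAddCommGroup
  let : InnerProductSpace ℝ H := .ofCore cd.toCore
  have hsq : ∀ y : H, ‖y‖ ^ 2 = cd.inner y y := fun y => (real_inner_self_eq_norm_sq y).symm
  let f : X ≃L[ℝ] H := e.toContinuousLinearEquivOfBounds D 1
    (fun x => (sq_le_sq₀ (norm_nonneg _) (by positivity)).1 ((hsq _).trans_le (he x).2))
    (fun y => (sq_le_sq₀ (norm_nonneg _) (by positivity)).1 (by
      rw [one_mul, hsq]
      simpa using (he (e.symm y)).1))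
  have hcomplete : CompleteSpace H :=
    (completeSpace_congr (e := f.toEquiv) f.isUniformEmbedding).1 inferInstance
  exact ⟨H, inferInstance, inferInstance, hcomplete, ⟨f⟩⟩

/-- A Banach space whose finite-dimensional subspaces are uniformly Hilbertian is isomorphic to a
Hilbert space. -/
theorem exists_hilbert_of_isHilbertianWith {X : Type} [NormedAddCommGroup X] [NormedSpace ℝ X]
    [CompleteSpace X] {D : ℝ} (hD : 0 ≤ D)
    (h : ∀ E : Submodule ℝ X, FiniteDimensional ℝ E → IsHilbertianWith E D) :
    ∃ (H : Type) (_ : NormedAddCommGroup H) (_ : InnerProductSpace ℝ H) (_ : CompleteSpace H),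
      Nonempty (X ≃L[ℝ] H) := by
  classical
  choose n j hj using fun s : Finset X => h (Submodule.span ℝ (s : Set X)) inferInstance
  let b : Finset X → X → X → ℝ := fun s x y =>
    if hxy : x ∈ Submodule.span ℝ (s : Set X) ∧ y ∈ Submodule.span ℝ (s : Set X) then
      ⟪j s ⟨x, hxy.1⟩, j s ⟨y, hxy.2⟩⟫ else 0
  have hb : ∀ (s : Finset X) (x y) (hx : x ∈ Submodule.span ℝ (s : Set X))
      (hy : y ∈ Submodule.span ℝ (s : Set X)), b s x y = ⟪j s ⟨x, hx⟩, j s ⟨y, hy⟩⟫ :=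
    fun s x y hx hy => dif_pos ⟨hx, hy⟩
  have hbound : ∀ (s : Finset X) (x y),
      b s x y ∈ Set.Icc (-(D * ‖x‖ * (D * ‖y‖))) (D * ‖x‖ * (D * ‖y‖)) :=
    fun s x y => by
      rw [Set.mem_Icc, ← abs_le]
      by_cases hxy : x ∈ Submodule.span ℝ (s : Set X) ∧ y ∈ Submodule.span ℝ (s : Set X)
      · rw [hb s x y hxy.1 hxy.2]
        refine (abs_real_inner_le_norm _ _).trans ?_
        gcongr
        exacts [(hj s _).2, (hj s _).2]
      · rw [show b s x y = 0 from dif_neg hxy, abs_zero]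
        positivity
  let 𝒰 : Ultrafilter (Finset X) := Ultrafilter.of atTop
  have h𝒰 : ∀ x : X, ∀ᶠ s : Finset X in (𝒰 : Filter (Finset X)), x ∈ Submodule.span ℝ (s : Set X) :=
    fun x => Ultrafilter.of_le atTop <| (eventually_ge_atTop {x}).mono fun s hs =>
      Submodule.subset_span (hs (Finset.mem_singleton_self x))
  have hlim : ∀ x y, ∃ l, Tendsto (fun s => b s x y) 𝒰 (𝓝 l) := fun x y => by
    obtain ⟨l, -, hl⟩ := isCompact_Icc.ultrafilter_le_nhds' (𝒰.map fun s => b s x y)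
      (Ultrafilter.mem_map.2 (univ_mem' fun s => hbound s x y))
    exact ⟨l, hl⟩
  choose B hB using hlim
  have hself : ∀ x, ‖x‖ ^ 2 ≤ B x x ∧ B x x ≤ (D * ‖x‖) ^ 2 := fun x => by
    constructor
    · refine ge_of_tendsto (hB x x) ((h𝒰 x).mono fun s hs => ?_)
      rw [hb s x x hs hs, real_inner_self_eq_norm_sq]
      exact pow_le_pow_left₀ (norm_nonneg _) (hj s ⟨x, hs⟩).1 2
    · refine le_of_tendsto (hB x x) (Eventually.of_forall fun s => ?_)
      rw [sq]
      exact (hbound s x x).2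
  let cd : InnerProductSpace.Core ℝ X :=
    { inner := B
      conj_inner_symm := fun x y => by
        change B y x = B x y
        refine tendsto_nhds_unique ((hB y x).congr' ?_) (hB x y)
        filter_upwards [h𝒰 x, h𝒰 y] with s hx hy
        rw [hb s y x hy hx, hb s x y hx hy, real_inner_comm]
      re_inner_nonneg := fun x => (sq_nonneg _).trans (hself x).1
      add_left := fun x y z => by
        refine tendsto_nhds_unique (hB (x + y) z) (((hB x z).add (hB y z)).congr' ?_)
        filter_upwards [h𝒰 x, h𝒰 y, h𝒰 z] with s hx hy hz
        rw [hb s x z hx hz, hb s y z hy hz, hb s _ z (add_mem hx hy) hz,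
          ← inner_add_left, ← map_add]
        rfl
      smul_left := fun x y r => by
        refine tendsto_nhds_unique (hB (r • x) y) (((hB x y).const_mul r).congr' ?_)
        filter_upwards [h𝒰 x, h𝒰 y] with s hx hy
        rw [hb s x y hx hy, hb s _ y (Submodule.smul_mem _ r hx) hy,
          ← real_inner_smul_left, ← map_smul]
        rfl
      definite := fun x hx => by
        have h1 := (hself x).1
        rw [hx] at h1
        exact norm_eq_zero.1 (pow_eq_zero_iff two_ne_zero |>.1 (le_antisymm h1 (sq_nonneg _))) }
  exact exists_hilbert_of_core cd (LinearEquiv.refl ℝ X) hD hself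

end Gluing

/-- For a Banach space of dimension at least 3, every bounded operator defined
on a closed subspace (into an arbitrary Banach space) extends to the whole
space iff the space is isomorphic to a Hilbert space
(Lindenstrauss–Tzafriri). -/
theorem extension_property_iff_hilbertian
    {X : Type} [NormedAddCommGroup X] [NormedSpace ℝ X] [CompleteSpace X]
    (hdim : 3 ≤ Module.rank ℝ X) :
    (∀ (Y : Submodule ℝ X), IsClosed (Y : Set X) →
      ∀ (Z : Type) [NormedAddCommGroup Z] [NormedSpace ℝ Z] [CompleteSpace Z]
        (T : Y →L[ℝ] Z), ∃ T' : X →L[ℝ] Z, ∀ y : Y, T' (y : X) = T y) ↔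
    (∃ (H : Type) (_ : NormedAddCommGroup H) (_ : InnerProductSpace ℝ H)
      (_ : CompleteSpace H), Nonempty (X ≃L[ℝ] H)) := by
  constructor
  · intro h
    by_cases hfin : FiniteDimensional ℝ X
    · exact ⟨EuclideanSpace ℝ (Fin (Module.finrank ℝ X)), inferInstance, inferInstance,
        inferInstance, ⟨ContinuousLinearEquiv.ofFinrankEq (by simp)⟩⟩
    obtain ⟨c, hc⟩ := exists_uniform_isComplementedWith (X := X) fun Y hY => by
      have : CompleteSpace Y := hY.completeSpace_coe
      obtain ⟨P, hP⟩ := h Y hY Y (ContinuousLinearMap.id ℝ Y)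
      exact ⟨Y.subtypeL.comp P, fun x => (P x).2, fun x hx => congrArg Subtype.val (hP ⟨x, hx⟩)⟩
    obtain ⟨D, hD, hX⟩ := exists_uniform_isHilbertianWith hfin hc
    exact exists_hilbert_of_isHilbertianWith hD hX
  · rintro ⟨H, _, _, _, ⟨e⟩⟩ Y hY Z _ _ _ T
    set W : Submodule ℝ H := Y.map e.toLinearEquiv.toLinearMap
    have hW : IsClosed (W : Set H) := by
      rw [Submodule.map_coe]
      exact e.toHomeomorph.isClosedMap _ hY
    have : CompleteSpace W := hW.completeSpace_coe
    have hmem : ∀ w : W, e.symm w ∈ Y := by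
      rintro ⟨_, y, hy, rfl⟩
      simpa using hy
    let S : W →L[ℝ] Y := (e.symm.toContinuousLinearMap.comp W.subtypeL).codRestrict Y hmem
    refine ⟨T.comp (S.comp (W.orthogonalProjectionOnto.comp e.toContinuousLinearMap)), fun y => ?_⟩
    have hy : e y ∈ W := Submodule.mem_map_of_mem y.2
    have h1 : W.orthogonalProjectionOnto (e y) = ⟨e y, hy⟩ :=
      Submodule.orthogonalProjectionOnto_mem_subspace_eq_self (⟨e y, hy⟩ : W)
    have h2 : S ⟨e y, hy⟩ = y := Subtype.ext (e.symm_apply_apply (y : X))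
    change T (S (W.orthogonalProjectionOnto (e y))) = T y
    rw [h1, h2]
end
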